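/- arXiv:2010.05203 — 16 statements merged into one kernel-verified Lean document; each statement's English description precedes it below -/
import Mathlib

section
/- Let ε be a real number with 0 < ε < 1 and let f be a continuous solution of the second type of FKS equation. If α ∈ [0,1] is a minimum point of f (i.e. f(α) ≤ f(x) for all x ∈ [0,1]), then f(α) = 0 and α > ε². -/
/-- If α ∈ [0,1] is a minimum point of f, then f(α) = 0 and α > ε². -/
theorem stmt_1 (ε : ℝ) (hε0 : 0 < ε) (hε1 : ε < 1) (f : ℝ → ℝ)
    (hmap : Set.MapsTo f (Set.Icc 0 1) (Set.Icc 0 1))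
    (hcont : ContinuousOn f (Set.Icc 0 1))
    (hf0 : f 0 = 1)
    (hfks : ∀ x ∈ Set.Icc (0:ℝ) 1, f (f (ε^2 * x)) = ε * f x)
    (α : ℝ) (hα : α ∈ Set.Icc (0:ℝ) 1)
    (hmin : ∀ x ∈ Set.Icc (0:ℝ) 1, f α ≤ f x) :
    f α = 0 ∧ ε^2 < α := by
  have hmem : ∀ x ∈ Set.Icc (0:ℝ) 1, ε ^ 2 * x ∈ Set.Icc (0:ℝ) 1 := fun x hx =>
    ⟨mul_nonneg (sq_nonneg ε) hx.1, mul_le_one₀ (pow_le_one₀ hε0.le hε1.le) hx.1 hx.2⟩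
  have hzero : f α = 0 := by
    have h := hmin _ (hmap (hmem α hα))
    rw [hfks α hα] at h
    have hnonneg := (hmap hα).1
    nlinarith
  refine ⟨hzero, ?_⟩
  by_contra! hle
  have hsq : 0 < ε ^ 2 := by positivity
  have hx : α / ε ^ 2 ∈ Set.Icc (0:ℝ) 1 :=
    ⟨div_nonneg hα.1 hsq.le, (div_le_one hsq).2 hle⟩
  have h := hfks _ hx
  rw [mul_div_cancel₀ α hsq.ne', hzero, hf0] at h
  have hle_one := (hmap hx).2
  nlinarith
end

section
/- Let ε be a real number with 0 < ε < 1 and let f be a continuous solution of the second type of FKS equation. Let α ∈ [0,1] be a minimum point of f. If x ∈ [0,ε²] satisfies f(x) = α, then there exists a minimum point β ∈ [0,1] of f such that x = ε²β. -/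
/-- Let α ∈ [0,1] be a minimum point of f. If x ∈ [0,ε²] satisfies
f(x) = α, then there exists a minimum point β ∈ [0,1] of f such that x = ε²β. -/
theorem stmt_2 (ε : ℝ) (hε0 : 0 < ε) (hε1 : ε < 1) (f : ℝ → ℝ)
    (hmap : Set.MapsTo f (Set.Icc 0 1) (Set.Icc 0 1))
    (hcont : ContinuousOn f (Set.Icc 0 1))
    (hf0 : f 0 = 1)
    (hfks : ∀ x ∈ Set.Icc (0:ℝ) 1, f (f (ε^2 * x)) = ε * f x)
    (α : ℝ) (hα : α ∈ Set.Icc (0:ℝ) 1)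
    (hmin : ∀ y ∈ Set.Icc (0:ℝ) 1, f α ≤ f y)
    (x : ℝ) (hx : x ∈ Set.Icc (0:ℝ) (ε^2)) (hfx : f x = α) :
    ∃ β ∈ Set.Icc (0:ℝ) 1, (∀ y ∈ Set.Icc (0:ℝ) 1, f β ≤ f y) ∧ x = ε^2 * β := by
  have hsq : 0 < ε ^ 2 := by positivity
  have hαmem : ε ^ 2 * α ∈ Set.Icc (0:ℝ) 1 :=
    ⟨mul_nonneg hsq.le hα.1, mul_le_one₀ (pow_le_one₀ hε0.le hε1.le) hα.1 hα.2⟩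
  have hle : f α ≤ ε * f α := hfks α hα ▸ hmin _ (hmap hαmem)
  have hzero : f α = 0 := le_antisymm (by nlinarith) (hmap hα).1
  have hβ : x / ε ^ 2 ∈ Set.Icc (0:ℝ) 1 :=
    ⟨div_nonneg hx.1 hsq.le, (div_le_one hsq).2 hx.2⟩
  have hxβ : x = ε ^ 2 * (x / ε ^ 2) := (mul_div_cancel₀ x hsq.ne').symm
  refine ⟨x / ε ^ 2, hβ, fun y hy => ?_, hxβ⟩
  have heq := hfks _ hβ
  rw [← hxβ, hfx, hzero] at heq
  have hfβ : f (x / ε ^ 2) = 0 := (mul_eq_zero.1 heq.symm).resolve_left hε0.ne'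
  exact hfβ ▸ (hmap hy).1
end

section
/- Let ε be a real number with 0 < ε < 1, let f be a continuous solution of the second type of FKS equation, and let [u,v] (with ε² < u ≤ v < 1) be the interval consisting of all minimum points of f. Then the image of [0, ε²u] under f equals [v,1], f(ε²u) = v, and the image of [ε²u, ε²v] under f is contained in [u,v]. -/
/-- f '' [0, ε²u] = [v,1], f(ε²u) = v, and f '' [ε²u, ε²v] ⊆ [u,v]. -/
theorem stmt_4 (ε : ℝ) (hε0 : 0 < ε) (hε1 : ε < 1) (f : ℝ → ℝ)
    (hmap : Set.MapsTo f (Set.Icc 0 1) (Set.Icc 0 1))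
    (hcont : ContinuousOn f (Set.Icc 0 1))
    (hf0 : f 0 = 1)
    (hfks : ∀ x ∈ Set.Icc (0:ℝ) 1, f (f (ε^2 * x)) = ε * f x)
    (u v : ℝ) (hu : ε^2 < u) (huv : u ≤ v) (hv : v < 1)
    (hminset : {α | α ∈ Set.Icc (0:ℝ) 1 ∧ ∀ x ∈ Set.Icc (0:ℝ) 1, f α ≤ f x} = Set.Icc u v) :
    f '' Set.Icc 0 (ε^2 * u) = Set.Icc v 1 ∧ f (ε^2 * u) = v ∧
      f '' Set.Icc (ε^2 * u) (ε^2 * v) ⊆ Set.Icc u v := by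
  have hε2 : 0 < ε ^ 2 := by positivity
  have hε21 : ε ^ 2 < 1 := by nlinarith
  have hu0 : 0 < u := hε2.trans hu
  have scale : ∀ x ∈ Set.Icc (0 : ℝ) 1, ε ^ 2 * x ∈ Set.Icc (0 : ℝ) 1 := fun x hx =>
    ⟨mul_nonneg hε2.le hx.1, mul_le_one₀ hε21.le hx.1 hx.2⟩
  obtain ⟨huI, humin⟩ : u ∈ {α | α ∈ Set.Icc (0:ℝ) 1 ∧ ∀ x ∈ Set.Icc (0:ℝ) 1, f α ≤ f x} :=
    hminset ▸ ⟨le_rfl, huv⟩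
  have hfu : f u = 0 := by
    have h1 := humin _ (hmap (scale u huI))
    rw [hfks u huI] at h1
    have h2 := (hmap huI).1
    nlinarith
  have zero_iff : ∀ x ∈ Set.Icc (0 : ℝ) 1, (f x = 0 ↔ x ∈ Set.Icc u v) := by
    intro x hx
    rw [← hminset]
    refine ⟨fun h => ⟨hx, fun y hy => h ▸ (hmap hy).1⟩, fun h => ?_⟩
    exact le_antisymm (hfu ▸ h.2 u huI) (hmap hx).1
  have mem_iff : ∀ x ∈ Set.Icc (0 : ℝ) 1, (f (ε ^ 2 * x) ∈ Set.Icc u v ↔ x ∈ Set.Icc u v) := by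
    intro x hx
    rw [← zero_iff x hx, ← zero_iff _ (hmap (scale x hx)), hfks x hx]
    simp [hε0.ne']
  have ivt : ∀ x ∈ Set.Icc 0 (ε ^ 2 * u), Set.Icc (f x) 1 ⊆ f '' Set.Icc 0 x := by
    intro x hx
    have h := intermediate_value_Icc' hx.1
      (hcont.mono (Set.Icc_subset_Icc_right (hx.2.trans (scale u huI).2)))
    rwa [hf0] at h
  have lower : ∀ x ∈ Set.Icc 0 (ε ^ 2 * u), v ≤ f x := by
    intro x hx
    by_contra! hlt
    obtain ⟨y, hy, hyv⟩ := ivt x hx ⟨hlt.le, hv.le⟩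
    have hyu : y / ε ^ 2 ≤ u := by
      rw [div_le_iff₀ hε2, mul_comm]
      exact hy.2.trans hx.2
    have hyeq : ε ^ 2 * (y / ε ^ 2) = y := mul_div_cancel₀ y hε2.ne'
    have huy := ((mem_iff (y / ε ^ 2) ⟨div_nonneg hy.1 hε2.le, hyu.trans huI.2⟩).1
      (by rw [hyeq, hyv]; exact ⟨huv, le_rfl⟩)).1
    have hyu' : y = ε ^ 2 * u := by rw [← hyeq, le_antisymm hyu huy]
    have hxy : x = y := le_antisymm (hyu' ▸ hx.2) hy.2
    rw [hxy, hyv] at hlt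
    exact lt_irrefl _ hlt
  have hmem : ε ^ 2 * u ∈ Set.Icc 0 (ε ^ 2 * u) := ⟨(scale u huI).1, le_rfl⟩
  have hval : f (ε ^ 2 * u) = v :=
    le_antisymm ((mem_iff u huI).2 ⟨le_rfl, huv⟩).2 (lower _ hmem)
  refine ⟨Set.Subset.antisymm ?_ (hval ▸ ivt _ hmem), hval, ?_⟩
  · rintro _ ⟨x, hx, rfl⟩
    exact ⟨lower x hx, (hmap ⟨hx.1, hx.2.trans (scale u huI).2⟩).2⟩
  · rintro _ ⟨x, hx, rfl⟩
    have hxeq : ε ^ 2 * (x / ε ^ 2) = x := mul_div_cancel₀ x hε2.ne'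
    have hux : u ≤ x / ε ^ 2 := by
      rw [le_div_iff₀ hε2, mul_comm]
      exact hx.1
    have hxv : x / ε ^ 2 ≤ v := by
      rw [div_le_iff₀ hε2, mul_comm]
      exact hx.2
    rw [← hxeq]
    exact (mem_iff _ ⟨hu0.le.trans hux, hxv.trans hv.le⟩).2 ⟨hux, hxv⟩
end

section
/- Let ε be a real number with 0 < ε < 1, let f be a continuous solution of the second type of FKS equation, and let [u,v] (with ε² < u ≤ v < 1) be the interval consisting of all minimum points of f. Then the image of [v,1] under f equals [0,ε]. -/
/-- The image of [v,1] under f equals [0,ε]. -/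
theorem stmt_5 (ε : ℝ) (hε0 : 0 < ε) (hε1 : ε < 1) (f : ℝ → ℝ)
    (hmap : Set.MapsTo f (Set.Icc 0 1) (Set.Icc 0 1))
    (hcont : ContinuousOn f (Set.Icc 0 1))
    (hf0 : f 0 = 1)
    (hfks : ∀ x ∈ Set.Icc (0:ℝ) 1, f (f (ε^2 * x)) = ε * f x)
    (u v : ℝ) (hu : ε^2 < u) (huv : u ≤ v) (hv : v < 1)
    (hminset : {α | α ∈ Set.Icc (0:ℝ) 1 ∧ ∀ x ∈ Set.Icc (0:ℝ) 1, f α ≤ f x} = Set.Icc u v) :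
    f '' Set.Icc v 1 = Set.Icc 0 ε := by
  have hv0 : 0 < v := by nlinarith [sq_nonneg ε]
  have hvI : v ∈ Set.Icc (0:ℝ) 1 := ⟨hv0.le, hv.le⟩
  have hscale : ∀ x ∈ Set.Icc (0:ℝ) 1, ε ^ 2 * x ∈ Set.Icc (0:ℝ) 1 := fun x hx =>
    ⟨mul_nonneg (sq_nonneg ε) hx.1, mul_le_one₀ (by nlinarith) hx.1 hx.2⟩
  have hvmin : ∀ x ∈ Set.Icc (0:ℝ) 1, f v ≤ f x := by
    have h : v ∈ Set.Icc u v := ⟨huv, le_rfl⟩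
    rw [← hminset] at h
    exact h.2
  have hwI : f (ε ^ 2 * v) ∈ Set.Icc (0:ℝ) 1 := hmap (hscale v hvI)
  have hfv : f v = 0 := by
    have h1 := hvmin _ hwI
    rw [hfks v hvI] at h1
    nlinarith [(hmap hvI).1]
  have hwv : f (ε ^ 2 * v) ≤ v := by
    have h : f (ε ^ 2 * v) ∈ Set.Icc u v := by
      rw [← hminset]
      refine ⟨hwI, fun x hx => ?_⟩
      rw [hfks v hvI, hfv, mul_zero]
      exact (hmap hx).1
    exact h.2
  have hf1 : f 1 = ε := by
    simpa [hf0] using hfks 0 ⟨le_rfl, zero_le_one⟩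
  apply Set.Subset.antisymm
  · rintro _ ⟨y, hy, rfl⟩
    have hcomp : ContinuousOn (fun x => f (ε ^ 2 * x)) (Set.Icc 0 v) :=
      hcont.comp (by fun_prop) fun x hx => hscale x ⟨hx.1, hx.2.trans hv.le⟩
    obtain ⟨x, hx, rfl⟩ := intermediate_value_Icc' hv0.le hcomp
      (show y ∈ Set.Icc (f (ε ^ 2 * v)) (f (ε ^ 2 * 0)) by
        rw [mul_zero, hf0]
        exact ⟨hwv.trans hy.1, hy.2⟩)
    have hxI : x ∈ Set.Icc (0:ℝ) 1 := ⟨hx.1, hx.2.trans hv.le⟩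
    have hfx := hmap hxI
    simp only [hfks x hxI]
    exact ⟨mul_nonneg hε0.le hfx.1, mul_le_of_le_one_right hε0.le hfx.2⟩
  · have h := intermediate_value_Icc hv.le (hcont.mono (Set.Icc_subset_Icc_left hv0.le))
    rwa [hfv, hf1] at h
end

section
/- Let ε be a real number with 0 < ε < 1, let f be a continuous solution of the second type of FKS equation, and let [u,v] (with ε² < u ≤ v < 1) be the interval consisting of all minimum points of f. Then either f(ε²) > v or f(ε²) < u. -/
/-- Either f(ε²) > v or f(ε²) < u. -/
theorem stmt_6 (ε : ℝ) (hε0 : 0 < ε) (hε1 : ε < 1) (f : ℝ → ℝ)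
    (hmap : Set.MapsTo f (Set.Icc 0 1) (Set.Icc 0 1))
    (hcont : ContinuousOn f (Set.Icc 0 1))
    (hf0 : f 0 = 1)
    (hfks : ∀ x ∈ Set.Icc (0:ℝ) 1, f (f (ε^2 * x)) = ε * f x)
    (u v : ℝ) (hu : ε^2 < u) (huv : u ≤ v) (hv : v < 1)
    (hminset : {α | α ∈ Set.Icc (0:ℝ) 1 ∧ ∀ x ∈ Set.Icc (0:ℝ) 1, f α ≤ f x} = Set.Icc u v) :
    v < f (ε^2) ∨ f (ε^2) < u := by
  by_contra! hcon
  have minimal_of_mem {α : ℝ} (hα : α ∈ Set.Icc u v) :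
      α ∈ Set.Icc (0 : ℝ) 1 ∧ ∀ x ∈ Set.Icc (0 : ℝ) 1, f α ≤ f x := by
    rwa [← hminset] at hα
  have f_mem {x : ℝ} (hx : x ∈ Set.Icc (0 : ℝ) 1) : f (ε ^ 2 * x) ∈ Set.Icc (0 : ℝ) 1 :=
    hmap ⟨mul_nonneg (sq_nonneg ε) hx.1,
      mul_le_one₀ (pow_le_one₀ hε0.le hε1.le) hx.1 hx.2⟩
  have one_mem : (1 : ℝ) ∈ Set.Icc (0 : ℝ) 1 := ⟨zero_le_one, le_rfl⟩
  obtain ⟨hu_mem, hu_min⟩ := minimal_of_mem (Set.left_mem_Icc.mpr huv)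
  -- The functional equation at a minimum point forces the minimum value to be zero.
  have min_zero : f u = 0 := by
    have hle := hu_min _ (f_mem hu_mem)
    rw [hfks u hu_mem] at hle
    have hnonneg : 0 ≤ f u := (hmap hu_mem).1
    nlinarith
  -- If `f (ε ^ 2)` were a minimum point, then `1` would be one as well.
  have hmin := (minimal_of_mem (α := f (ε ^ 2)) ⟨hcon.2, hcon.1⟩).2 u hu_mem
  have hone := hfks 1 one_mem
  rw [mul_one] at hone
  have f_one : f 1 = 0 := by
    have hnonneg : 0 ≤ f 1 := (hmap one_mem).1
    nlinarith
  have hmem : (1 : ℝ) ∈ Set.Icc u v := by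
    rw [← hminset]
    exact ⟨one_mem, fun x hx => f_one.trans_le (hmap hx).1⟩
  exact hv.not_ge hmem.2
end

section
/- Let ε be a real number with 0 < ε < 1, let f be a continuous solution of the second type of FKS equation, and let [u,v] (with ε² < u ≤ v < 1) be the interval consisting of all minimum points of f. If f(ε²) > v, then the image of [ε²v, ε²] under f is contained in [v,1] and f(ε²v) = v. -/
/-- If f(ε²) > v, then f '' [ε²v, ε²] ⊆ [v,1] and f(ε²v) = v. -/
theorem stmt_7 (ε : ℝ) (hε0 : 0 < ε) (hε1 : ε < 1) (f : ℝ → ℝ)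
    (hmap : Set.MapsTo f (Set.Icc 0 1) (Set.Icc 0 1))
    (hcont : ContinuousOn f (Set.Icc 0 1))
    (hf0 : f 0 = 1)
    (hfks : ∀ x ∈ Set.Icc (0:ℝ) 1, f (f (ε^2 * x)) = ε * f x)
    (u v : ℝ) (hu : ε^2 < u) (huv : u ≤ v) (hv : v < 1)
    (hminset : {α | α ∈ Set.Icc (0:ℝ) 1 ∧ ∀ x ∈ Set.Icc (0:ℝ) 1, f α ≤ f x} = Set.Icc u v)
    (hfe : v < f (ε^2)) :
    f '' Set.Icc (ε^2 * v) (ε^2) ⊆ Set.Icc v 1 ∧ f (ε^2 * v) = v := by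
  have hε2 : 0 < ε ^ 2 := by positivity
  have hε21 : ε ^ 2 < 1 := by linarith
  have hv0 : 0 < v := by linarith
  have hvI : v ∈ Set.Icc (0 : ℝ) 1 := ⟨hv0.le, hv.le⟩
  have hmul : ∀ x ∈ Set.Icc (0 : ℝ) 1, ε ^ 2 * x ∈ Set.Icc (0 : ℝ) 1 := fun x hx =>
    ⟨mul_nonneg hε2.le hx.1, mul_le_one₀ hε21.le hx.1 hx.2⟩
  have hmin : ∀ α, (α ∈ Set.Icc (0 : ℝ) 1 ∧ ∀ x ∈ Set.Icc (0 : ℝ) 1, f α ≤ f x) ↔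
      α ∈ Set.Icc u v := fun α => Set.ext_iff.mp hminset α
  have hfv : f v = 0 := by
    have h1 := ((hmin v).mpr ⟨huv, le_rfl⟩).2 _ (hmap (hmul v hvI))
    rw [hfks v hvI] at h1
    nlinarith [(hmap hvI).1]
  have hzero : ∀ x ∈ Set.Icc (0 : ℝ) 1, f x = 0 → x ∈ Set.Icc u v := fun x hx h0 =>
    (hmin x).mp ⟨hx, fun y hy => h0 ▸ (hmap hy).1⟩
  have hge : ∀ t ∈ Set.Icc (ε ^ 2 * v) (ε ^ 2), v ≤ f t := by
    intro t ht
    by_contra! hlt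
    have ht0 : 0 ≤ t := (mul_pos hε2 hv0).le.trans ht.1
    obtain ⟨s, hs, hfs⟩ := intermediate_value_Icc ht.2
      (hcont.mono (Set.Icc_subset_Icc ht0 hε21.le)) ⟨hlt.le, hfe.le⟩
    have hsz : ε ^ 2 * (s / ε ^ 2) = s := mul_div_cancel₀ s hε2.ne'
    have hzI : s / ε ^ 2 ∈ Set.Icc (0 : ℝ) 1 :=
      ⟨div_nonneg (ht0.trans hs.1) hε2.le, (div_le_one hε2).mpr hs.2⟩
    have hz := hfks _ hzI
    rw [hsz, hfs, hfv] at hz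
    have hz0 : f (s / ε ^ 2) = 0 := (mul_eq_zero.mp hz.symm).resolve_left hε0.ne'
    have hsv : s ≤ ε ^ 2 * v := by
      rw [← hsz]
      exact mul_le_mul_of_nonneg_left (hzero _ hzI hz0).2 hε2.le
    have hst : s = t := le_antisymm (hsv.trans ht.1) hs.1
    exact hlt.ne (hst ▸ hfs)
  refine ⟨?_, le_antisymm ?_ (hge _ ⟨le_rfl, mul_le_of_le_one_right hε2.le hv.le⟩)⟩
  · rintro _ ⟨t, ht, rfl⟩
    exact ⟨hge t ht, (hmap ⟨(mul_pos hε2 hv0).le.trans ht.1, ht.2.trans hε21.le⟩).2⟩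
  · refine (hzero _ (hmap (hmul v hvI)) ?_).2
    rw [hfks v hvI, hfv, mul_zero]
end

section
/- Let ε be a real number with 0 < ε < 1, let f be a continuous solution of the second type of FKS equation, and let [u,v] (with ε² < u ≤ v < 1) be the interval consisting of all minimum points of f. If f(ε²) < u, then the image of [ε²u, ε²v] under f equals [u,v], the image of [ε²v, ε²] under f is contained in [ε²u, u], and f(ε²v) = u. -/
/-- If f(ε²) < u, then f '' [ε²u, ε²v] = [u,v],
f '' [ε²v, ε²] ⊆ [ε²u, u], and f(ε²v) = u. -/
theorem stmt_8 (ε : ℝ) (hε0 : 0 < ε) (hε1 : ε < 1) (f : ℝ → ℝ)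
    (hmap : Set.MapsTo f (Set.Icc 0 1) (Set.Icc 0 1))
    (hcont : ContinuousOn f (Set.Icc 0 1))
    (hf0 : f 0 = 1)
    (hfks : ∀ x ∈ Set.Icc (0:ℝ) 1, f (f (ε^2 * x)) = ε * f x)
    (u v : ℝ) (hu : ε^2 < u) (huv : u ≤ v) (hv : v < 1)
    (hminset : {α | α ∈ Set.Icc (0:ℝ) 1 ∧ ∀ x ∈ Set.Icc (0:ℝ) 1, f α ≤ f x} = Set.Icc u v)
    (hfe : f (ε^2) < u) :
    f '' Set.Icc (ε^2 * u) (ε^2 * v) = Set.Icc u v ∧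
      f '' Set.Icc (ε^2 * v) (ε^2) ⊆ Set.Icc (ε^2 * u) u ∧
      f (ε^2 * v) = u := by
  have he : 0 < ε ^ 2 := by positivity
  have he1 : ε ^ 2 < 1 := by nlinarith
  have mem : ∀ x ∈ Set.Icc (0:ℝ) 1, ε ^ 2 * x ∈ Set.Icc (0:ℝ) 1 := fun x hx =>
    ⟨mul_nonneg he.le hx.1, by nlinarith [hx.1, hx.2]⟩
  have key : ∀ x, (x ∈ Set.Icc (0:ℝ) 1 ∧ ∀ y ∈ Set.Icc (0:ℝ) 1, f x ≤ f y) ↔ x ∈ Set.Icc u v :=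
    fun x => Set.ext_iff.mp hminset x
  have hu0 : 0 < u := he.trans hu
  have hmin0 : f u = 0 := by
    obtain ⟨hu1, hu2⟩ := (key u).2 ⟨le_rfl, huv⟩
    have h1 := hu2 _ (hmap (mem u hu1))
    rw [hfks u hu1] at h1
    have h2 := (hmap hu1).1
    nlinarith
  have zero : ∀ x ∈ Set.Icc (0:ℝ) 1, (f x = 0 ↔ x ∈ Set.Icc u v) := by
    intro x hx
    rw [← key x]
    refine ⟨fun h => ⟨hx, fun y hy => h ▸ (hmap hy).1⟩, fun h => le_antisymm ?_ (hmap hx).1⟩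
    exact hmin0 ▸ h.2 u ⟨hu0.le, (huv.trans_lt hv).le⟩
  set g : ℝ → ℝ := fun x => f (ε ^ 2 * x) with hg
  have gmem : ∀ x ∈ Set.Icc (0:ℝ) 1, g x ∈ Set.Icc (0:ℝ) 1 := fun x hx => hmap (mem x hx)
  have gcont : ContinuousOn g (Set.Icc 0 1) :=
    hcont.comp (by fun_prop) mem
  have giff : ∀ x ∈ Set.Icc (0:ℝ) 1, (g x ∈ Set.Icc u v ↔ x ∈ Set.Icc u v) := by
    intro x hx
    rw [← zero x hx, ← zero _ (gmem x hx)]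
    show f (f (ε ^ 2 * x)) = 0 ↔ _
    rw [hfks x hx]
    simp [hε0.ne']
  have g0 : g 0 = 1 := by simp [hg, hf0]
  have g1 : g 1 < u := by simpa [hg] using hfe
  have sub : ∀ a b : ℝ, 0 ≤ a → b ≤ 1 → Set.Icc a b ⊆ Set.Icc (0:ℝ) 1 := fun a b ha hb =>
    Set.Icc_subset_Icc ha hb
  have left : ∀ x, 0 ≤ x → x < u → v < g x := by
    intro x h0 hx
    by_contra! h
    obtain ⟨y, hy, hyv⟩ := intermediate_value_Icc' h0
      (gcont.mono (sub 0 x le_rfl (by linarith))) ⟨h, by rw [g0]; exact hv.le⟩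
    have := (giff y ⟨hy.1, by linarith [hy.2]⟩).1 (by rw [hyv]; exact ⟨huv, le_rfl⟩)
    linarith [this.1, hy.2]
  have right : ∀ x, v < x → x ≤ 1 → g x < u := by
    intro x hx h1
    by_contra! h
    obtain ⟨y, hy, hyv⟩ := intermediate_value_Icc' h1
      (gcont.mono (sub x 1 (by linarith) le_rfl)) ⟨g1.le, h⟩
    have := (giff y ⟨by linarith [hy.1], hy.2⟩).1 (by rw [hyv]; exact ⟨le_rfl, huv⟩)
    linarith [this.2, hy.1]
  have hguv : ∀ x ∈ Set.Icc u v, g x ∈ Set.Icc u v := fun x hx =>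
    (giff x ⟨by linarith [hx.1], by linarith [hx.2]⟩).2 hx
  have gv : g v = u := by
    refine le_antisymm ?_ (hguv v ⟨huv, le_rfl⟩).1
    by_contra! h
    obtain ⟨y, hy, hyv⟩ := intermediate_value_Icc' hv.le
      (gcont.mono (sub v 1 (by linarith) le_rfl))
      (show (u + g v) / 2 ∈ Set.Icc (g 1) (g v) from ⟨by linarith, by linarith⟩)
    rcases eq_or_lt_of_le hy.1 with h' | h'
    · rw [← h'] at hyv; linarith
    · linarith [right y h' hy.2]
  have gu : g u = v := by
    refine le_antisymm (hguv u ⟨le_rfl, huv⟩).2 ?_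
    by_contra! h
    obtain ⟨y, hy, hyv⟩ := intermediate_value_Icc' hu0.le
      (gcont.mono (sub 0 u le_rfl (by linarith)))
      (show (v + g u) / 2 ∈ Set.Icc (g u) (g 0) from ⟨by linarith, by linarith⟩)
    rcases eq_or_lt_of_le hy.2 with h' | h'
    · rw [h'] at hyv; linarith
    · linarith [left y hy.1 h']
  have bound : ∀ y ∈ Set.Icc v 1, f y ≤ ε := by
    intro y hy
    obtain ⟨x, hx, rfl⟩ := intermediate_value_Icc' hu0.le
      (gcont.mono (sub 0 u le_rfl (by linarith))) (by rwa [gu, g0])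
    have hx1 : x ∈ Set.Icc (0:ℝ) 1 := ⟨hx.1, by linarith [hx.2]⟩
    show f (f (ε ^ 2 * x)) ≤ ε
    rw [hfks x hx1]
    nlinarith [(hmap hx1).2]
  refine ⟨Set.Subset.antisymm ?_ ?_, ?_, gv⟩
  · rintro _ ⟨t, ht, rfl⟩
    have hxt : ε ^ 2 * (t / ε ^ 2) = t := by field_simp
    have := hguv (t / ε ^ 2)
      ⟨(le_div_iff₀' he).2 ht.1, (div_le_iff₀' he).2 ht.2⟩
    simpa only [hg, hxt] using this
  · intro y hy
    obtain ⟨x, hx, rfl⟩ := intermediate_value_Icc' huv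
      (gcont.mono (sub u v hu0.le hv.le)) (by rwa [gu, gv])
    exact ⟨ε ^ 2 * x, ⟨by gcongr; exact hx.1, by gcongr; exact hx.2⟩, rfl⟩
  · rintro _ ⟨t, ht, rfl⟩
    obtain ⟨x, rfl⟩ : ∃ x, t = ε ^ 2 * x := ⟨t / ε ^ 2, by field_simp⟩
    have hvx : v ≤ x := le_of_mul_le_mul_left ht.1 he
    have hx1 : x ≤ 1 := le_of_mul_le_mul_left (by linarith [ht.2]) he
    have hx : x ∈ Set.Icc (0:ℝ) 1 := ⟨by linarith, hx1⟩
    constructor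
    · by_contra! h
      have hlt : f (ε ^ 2 * x) / ε ^ 2 < u := (div_lt_iff₀' he).2 h
      have h1 := left _ (div_nonneg (gmem x hx).1 he.le) hlt
      have hxt : ε ^ 2 * (f (ε ^ 2 * x) / ε ^ 2) = f (ε ^ 2 * x) := by field_simp
      simp only [hg, hxt] at h1
      rw [hfks x hx] at h1
      nlinarith [bound x ⟨hvx, hx1⟩]
    · rcases eq_or_lt_of_le hvx with h | h
      · exact h ▸ gv.le
      · exact (right x h hx1).le
end

section
/- Let ε be a real number with 0 < ε < 1 and let f be a single-valley-extended solution of the second type of FKS equation with platform [u,v]. Then the equation f(x) = εx has the unique solution x = 1 on the interval [u,1]; that is, for every x ∈ [u,1], f(x) = εx if and only if x = 1. -/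
/-- For a single-valley-extended solution with platform [u,v],
the equation f(x) = εx has the unique solution x = 1 on [u,1]. -/
theorem stmt_9 (ε : ℝ) (hε0 : 0 < ε) (hε1 : ε < 1) (f : ℝ → ℝ)
    (hmap : Set.MapsTo f (Set.Icc 0 1) (Set.Icc 0 1))
    (hcont : ContinuousOn f (Set.Icc 0 1))
    (hf0 : f 0 = 1)
    (hfks : ∀ x ∈ Set.Icc (0:ℝ) 1, f (f (ε^2 * x)) = ε * f x)
    (u v : ℝ) (hu : ε^2 < u) (huv : u < v) (hv : v < 1)
    (hdec : StrictAntiOn f (Set.Icc (ε^2) u))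
    (hplat : ∀ x ∈ Set.Icc u v, f x = 0)
    (hinc : StrictMonoOn f (Set.Icc v 1))
    (hminset : {α | α ∈ Set.Icc (0:ℝ) 1 ∧ ∀ x ∈ Set.Icc (0:ℝ) 1, f α ≤ f x} = Set.Icc u v) :
    ∀ x ∈ Set.Icc u 1, (f x = ε * x ↔ x = 1) := by
  have hε2 : 0 < ε ^ 2 := by positivity
  have hε2_lt : ε ^ 2 < 1 := by linarith
  have hu0 : 0 < u := hε2.trans hu
  have zero_mem_platform : ∀ z ∈ Set.Icc (0:ℝ) 1, f z = 0 → z ∈ Set.Icc u v := by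
    intro z hz hfz
    rw [← hminset]
    exact ⟨hz, fun y hy => hfz ▸ (hmap hy).1⟩
  have lt_of_scaled : ∀ s, 0 ≤ s → s < u → v < f (ε ^ 2 * s) := by
    intro s hs0 hsu
    by_contra! hle
    have hs1 : ε ^ 2 * s ≤ 1 := by nlinarith
    obtain ⟨y, hy, hfy⟩ := intermediate_value_Icc' (by positivity : 0 ≤ ε ^ 2 * s)
      (hcont.mono (Set.Icc_subset_Icc_right hs1)) ⟨hle, by rw [hf0]; exact hv.le⟩
    have hys : y / ε ^ 2 ≤ s := by rw [div_le_iff₀ hε2]; linarith [hy.2]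
    have hy_mem : y / ε ^ 2 ∈ Set.Icc (0:ℝ) 1 :=
      ⟨div_nonneg hy.1 hε2.le, by linarith⟩
    have h := hfks _ hy_mem
    rw [mul_div_cancel₀ _ hε2.ne', hfy, hplat v ⟨huv.le, le_rfl⟩] at h
    have hzero : f (y / ε ^ 2) = 0 :=
      (mul_eq_zero.mp h.symm).resolve_left hε0.ne'
    linarith [(zero_mem_platform _ hy_mem hzero).1]
  intro x hx
  refine ⟨fun hfx => ?_, ?_⟩
  · have hvx : v < x := by
      by_contra! hxv
      have : 0 < ε * x := mul_pos hε0 (hu0.trans_le hx.1)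
      rw [← hfx, hplat x ⟨hx.1, hxv⟩] at this
      exact this.false
    obtain ⟨s, hs, hfs⟩ := intermediate_value_Icc' hu0.le
      (hcont.mono (Set.Icc_subset_Icc_right (by linarith)))
      (show x ∈ Set.Icc (f u) (f 0) by
        rw [hf0, hplat u ⟨le_rfl, huv.le⟩]; exact ⟨by linarith, hx.2⟩)
    have hsu : s < u := by
      refine lt_of_le_of_ne hs.2 ?_
      rintro rfl
      rw [hplat s ⟨le_rfl, huv.le⟩] at hfs
      linarith
    have orbit : ∀ n : ℕ, (ε ^ 2) ^ n * s ∈ Set.Ico 0 u ∧ f ((ε ^ 2) ^ n * s) = x := by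
      intro n
      induction n with
      | zero => simpa using ⟨⟨hs.1, hsu⟩, hfs⟩
      | succ n ih =>
        obtain ⟨⟨h0, h1⟩, h2⟩ := ih
        rw [pow_succ', mul_assoc]
        generalize (ε ^ 2) ^ n * s = t at h0 h1 h2 ⊢
        have ht1 : t ≤ 1 := by linarith
        refine ⟨⟨by positivity, by nlinarith⟩, ?_⟩
        have hmem : f (ε ^ 2 * t) ∈ Set.Icc v 1 :=
          ⟨(lt_of_scaled t h0 h1).le, (hmap ⟨by positivity, by nlinarith⟩).2⟩
        apply hinc.injOn hmem ⟨hvx.le, hx.2⟩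
        rw [hfks t ⟨h0, ht1⟩, h2, hfx]
    have hlim : Filter.Tendsto (fun n : ℕ => (ε ^ 2) ^ n * s) Filter.atTop
        (nhdsWithin 0 (Set.Icc 0 1)) := by
      refine tendsto_nhdsWithin_iff.mpr ⟨?_, Filter.Eventually.of_forall fun n => ?_⟩
      · simpa using (tendsto_pow_atTop_nhds_zero_of_lt_one hε2.le hε2_lt).mul_const s
      · exact ⟨(orbit n).1.1, by linarith [(orbit n).1.2]⟩
    have hflim := (hcont 0 ⟨le_rfl, zero_le_one⟩).tendsto.comp hlim
    rw [hf0] at hflim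
    refine tendsto_nhds_unique (tendsto_const_nhds.congr fun n => ?_) hflim
    exact (orbit n).2.symm
  · rintro rfl
    simpa [hf0] using hfks 0 ⟨le_rfl, zero_le_one⟩
end

section
/- Let ε be a real number with 0 < ε < 1 and let f be a single-valley-extended solution of the second type of FKS equation with platform [u,v]. Then f(ε²) ≥ ε². -/
/-- For a single-valley-extended solution with platform [u,v],
f(ε²) ≥ ε². -/
theorem stmt_10 (ε : ℝ) (hε0 : 0 < ε) (hε1 : ε < 1) (f : ℝ → ℝ)
    (hmap : Set.MapsTo f (Set.Icc 0 1) (Set.Icc 0 1))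
    (hcont : ContinuousOn f (Set.Icc 0 1))
    (hf0 : f 0 = 1)
    (hfks : ∀ x ∈ Set.Icc (0:ℝ) 1, f (f (ε^2 * x)) = ε * f x)
    (u v : ℝ) (hu : ε^2 < u) (huv : u < v) (hv : v < 1)
    (hdec : StrictAntiOn f (Set.Icc (ε^2) u))
    (hplat : ∀ x ∈ Set.Icc u v, f x = 0)
    (hinc : StrictMonoOn f (Set.Icc v 1))
    (hminset : {α | α ∈ Set.Icc (0:ℝ) 1 ∧ ∀ x ∈ Set.Icc (0:ℝ) 1, f α ≤ f x} = Set.Icc u v) :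
    ε^2 ≤ f (ε^2) := by
  by_contra! hlt
  have hε2 : 0 < ε ^ 2 := by positivity
  have hε2' : ε ^ 2 < 1 := by nlinarith
  have hv0 : 0 < v := by linarith
  have hcontr : ∀ x ∈ Set.Icc (0:ℝ) 1, ε ^ 2 * x ∈ Set.Icc (0:ℝ) 1 := fun x hx =>
    ⟨mul_nonneg hε2.le hx.1, mul_le_one₀ hε2'.le hx.1 hx.2⟩
  have hvI : v ∈ Set.Icc (0:ℝ) 1 := ⟨hv0.le, hv.le⟩
  have huI : u ∈ Set.Icc (0:ℝ) 1 := ⟨by linarith, by linarith⟩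
  have hfv : u ≤ f (ε ^ 2 * v) := by
    have hmem : f (ε ^ 2 * v) ∈ Set.Icc u v := by
      rw [← hminset]
      refine ⟨hmap (hcontr v hvI), fun x hx => ?_⟩
      rw [hfks v hvI, hplat v ⟨huv.le, le_rfl⟩, mul_zero]
      exact (hmap hx).1
    exact hmem.1
  have hvε : ε ^ 2 * v < ε ^ 2 := by nlinarith
  -- A fixed point `p = ε² q` of `f` gives `f q = ε q` with `v < q < 1`.
  obtain ⟨p, ⟨hp1, hp2⟩, hp⟩ : ∃ p ∈ Set.Ioo (ε ^ 2 * v) (ε ^ 2), f p - p = 0 := by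
    have hc : ContinuousOn (fun x => f x - x) (Set.Icc (ε ^ 2 * v) (ε ^ 2)) :=
      (hcont.mono (Set.Icc_subset_Icc (hcontr v hvI).1 hε2'.le)).sub continuousOn_id
    exact intermediate_value_Ioo' hvε.le hc ⟨by linarith, by linarith⟩
  replace hp : f p = p := sub_eq_zero.mp hp
  obtain ⟨q, rfl⟩ : ∃ q, p = ε ^ 2 * q := ⟨p / ε ^ 2, by field_simp⟩
  have hvq : v < q := lt_of_mul_lt_mul_left hp1 hε2.le
  have hq1 : q < 1 := by nlinarith
  have hfq : f q = ε * q := by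
    have h := hfks q ⟨by linarith, hq1.le⟩
    rw [hp, hp] at h
    exact mul_left_cancel₀ hε0.ne' (by linarith)
  -- The values of `f` along `ε²ⁿ u` stay below `q`, although they tend to `f 0 = 1`.
  have hbound : ∀ n : ℕ, (ε ^ 2) ^ n * u ∈ Set.Icc (0:ℝ) 1 ∧ f ((ε ^ 2) ^ n * u) < q := by
    intro n
    induction n with
    | zero =>
      rw [pow_zero, one_mul, hplat u ⟨le_rfl, huv.le⟩]
      exact ⟨huI, by linarith⟩
    | succ n ih =>
      rw [pow_succ', mul_assoc]
      refine ⟨hcontr _ ih.1, ?_⟩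
      by_contra! hge
      have hmono := hinc.monotoneOn ⟨hvq.le, hq1.le⟩
        ⟨hvq.le.trans hge, (hmap (hcontr _ ih.1)).2⟩ hge
      rw [hfks _ ih.1, hfq] at hmono
      exact absurd (le_of_mul_le_mul_left hmono hε0) (not_le.mpr ih.2)
  have hlim : Filter.Tendsto (fun n : ℕ => (ε ^ 2) ^ n * u) Filter.atTop
      (nhdsWithin 0 (Set.Icc 0 1)) := by
    refine tendsto_nhdsWithin_iff.mpr ⟨?_, Filter.Eventually.of_forall fun n => (hbound n).1⟩
    simpa using (tendsto_pow_atTop_nhds_zero_of_lt_one hε2.le hε2').mul_const u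
  have hle : f 0 ≤ q := le_of_tendsto' ((hcont 0 ⟨le_rfl, zero_le_one⟩).tendsto.comp hlim)
    fun n => (hbound n).2.le
  linarith
end

section
/- Let ε be a real number with 0 < ε < 1 and let f be a single-valley-extended solution of the second type of FKS equation with platform [u,v]. If f(ε²) < u, then the image of [ε²v, ε²] under f is contained in [ε², u]. -/
/-- If f(ε²) < u, then f '' [ε²v, ε²] ⊆ [ε², u]. -/
theorem stmt_11 (ε : ℝ) (hε0 : 0 < ε) (hε1 : ε < 1) (f : ℝ → ℝ)
    (hmap : Set.MapsTo f (Set.Icc 0 1) (Set.Icc 0 1))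
    (hcont : ContinuousOn f (Set.Icc 0 1))
    (hf0 : f 0 = 1)
    (hfks : ∀ x ∈ Set.Icc (0:ℝ) 1, f (f (ε^2 * x)) = ε * f x)
    (u v : ℝ) (hu : ε^2 < u) (huv : u < v) (hv : v < 1)
    (hdec : StrictAntiOn f (Set.Icc (ε^2) u))
    (hplat : ∀ x ∈ Set.Icc u v, f x = 0)
    (hinc : StrictMonoOn f (Set.Icc v 1))
    (hminset : {α | α ∈ Set.Icc (0:ℝ) 1 ∧ ∀ x ∈ Set.Icc (0:ℝ) 1, f α ≤ f x} = Set.Icc u v)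
    (hfe : f (ε^2) < u) :
    f '' Set.Icc (ε^2 * v) (ε^2) ⊆ Set.Icc (ε^2) u := by
  have hε2 : 0 < ε ^ 2 := by positivity
  have hε2' : ε ^ 2 < 1 := by nlinarith
  have hu0 : 0 < u := hε2.trans hu
  have hscale : ∀ x ∈ Set.Icc (0 : ℝ) 1, ε ^ 2 * x ∈ Set.Icc (0 : ℝ) 1 := fun x hx =>
    ⟨mul_nonneg hε2.le hx.1, mul_le_one₀ hε2'.le hx.1 hx.2⟩
  have hg : ContinuousOn (fun x => f (ε ^ 2 * x)) (Set.Icc 0 1) :=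
    hcont.comp (by fun_prop) hscale
  have hzero : ∀ z ∈ Set.Icc (0 : ℝ) 1, f z = 0 → z ∈ Set.Icc u v := by
    intro z hz hfz
    rw [← hminset]
    exact ⟨hz, fun x hx => hfz ▸ (hmap hx).1⟩
  have hzero_of : ∀ x ∈ Set.Icc (0 : ℝ) 1, f (ε ^ 2 * x) ∈ Set.Icc u v → x ∈ Set.Icc u v := by
    intro x hx hgx
    refine hzero x hx ?_
    have h := hfks x hx
    rw [hplat _ hgx] at h
    exact (mul_eq_zero.mp h.symm).resolve_left hε0.ne'
  have hf1 : f 1 = ε := by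
    have h := hfks 0 (by simp)
    simpa [hf0] using h
  have h_upper : ∀ x ∈ Set.Icc v 1, f (ε ^ 2 * x) ≤ u := by
    intro x hx
    by_contra! hlt
    obtain ⟨z, hz, hgz⟩ := intermediate_value_Icc' hx.2
      (hg.mono (Set.Icc_subset_Icc_left (by linarith [hx.1])))
      (show u ∈ Set.Icc (f (ε ^ 2 * 1)) (f (ε ^ 2 * x)) from ⟨by simpa using hfe.le, hlt.le⟩)
    dsimp only at hgz
    have hzv := (hzero_of z ⟨by linarith [hx.1, hz.1], hz.2⟩ ⟨hgz.ge, hgz.trans_le huv.le⟩).2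
    have hzx : z = x := le_antisymm (hzv.trans hx.1) hz.1
    rw [hzx] at hgz
    exact hlt.ne' hgz
  have h_left : ∀ x ∈ Set.Ico 0 u, v < f (ε ^ 2 * x) := by
    intro x hx
    by_contra! hle
    obtain ⟨z, hz, hgz⟩ := intermediate_value_Icc' hx.1
      (hg.mono (Set.Icc_subset_Icc_right (by linarith [hx.2])))
      (show v ∈ Set.Icc (f (ε ^ 2 * x)) (f (ε ^ 2 * 0)) from ⟨hle, by simp [hf0, hv.le]⟩)
    dsimp only at hgz
    have hzu := (hzero_of z ⟨hz.1, by linarith [hx.2, hz.2]⟩ ⟨huv.le.trans hgz.ge, hgz.le⟩).1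
    linarith [hx.2, hz.2]
  have hgv : f (ε ^ 2 * v) = u := by
    have hv01 : v ∈ Set.Icc (0 : ℝ) 1 := ⟨by linarith, hv.le⟩
    refine le_antisymm (h_upper v ⟨le_rfl, hv.le⟩) (hzero _ (hmap (hscale v hv01)) ?_).1
    rw [hfks v hv01, hplat v ⟨huv.le, le_rfl⟩, mul_zero]
  have h_end : ε ^ 2 ≤ f (ε ^ 2) := by
    by_contra! hlt
    obtain ⟨y, hy⟩ : ∃ y, f (ε ^ 2) = ε ^ 2 * y := ⟨f (ε ^ 2) / ε ^ 2, by field_simp⟩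
    have hp0 : 0 ≤ f (ε ^ 2) := (hmap ⟨hε2.le, hε2'.le⟩).1
    have hy0 : 0 ≤ y := nonneg_of_mul_nonneg_right (hy ▸ hp0) hε2
    have hy1 : y < 1 := by
      rw [hy] at hlt
      exact (mul_lt_iff_lt_one_right hε2).mp hlt
    have hgy : f (ε ^ 2 * y) = ε ^ 2 := by
      have h := hfks 1 (by simp)
      rw [mul_one, hf1, hy] at h
      rw [h, sq]
    have hfy : f y = ε * y := by
      have h := hfks y ⟨hy0, hy1.le⟩
      rw [hgy, hy] at h
      apply mul_left_cancel₀ hε0.ne'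
      linarith
    have hvy : v < y := by
      by_contra! hyv
      rcases lt_or_ge y u with hyu | huy
      · linarith [h_left y ⟨hy0, hyu⟩]
      · have h := hplat y ⟨huy, hyv⟩
        have : 0 < ε * y := mul_pos hε0 (hu0.trans_le huy)
        linarith
    have hmem : ∀ n : ℕ, (ε ^ 2) ^ n * u ∈ Set.Icc (0 : ℝ) 1 := fun n =>
      ⟨by positivity, mul_le_one₀ (pow_le_one₀ hε2.le hε2'.le) hu0.le (by linarith)⟩
    have hbound : ∀ n : ℕ, f ((ε ^ 2) ^ n * u) ≤ y := by
      intro n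
      induction n with
      | zero => simpa [hplat u ⟨le_rfl, huv.le⟩] using hy0
      | succ n ih =>
        by_contra! hgt
        have hinc' := hinc ⟨hvy.le, hy1.le⟩ ⟨by linarith, (hmap (hmem (n + 1))).2⟩ hgt
        rw [pow_succ', mul_assoc, hfks _ (hmem n), hfy] at hinc'
        exact absurd (lt_of_mul_lt_mul_left hinc' hε0.le) ih.not_gt
    have hlim : Filter.Tendsto (fun n : ℕ => (ε ^ 2) ^ n * u) Filter.atTop
        (nhdsWithin 0 (Set.Icc 0 1)) := by
      refine tendsto_nhdsWithin_iff.mpr ⟨?_, Filter.Eventually.of_forall hmem⟩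
      simpa using (tendsto_pow_atTop_nhds_zero_of_lt_one hε2.le hε2').mul_const u
    have h1y : f 0 ≤ y :=
      le_of_tendsto ((hcont 0 (by simp)).tendsto.comp hlim) (Filter.Eventually.of_forall hbound)
    linarith
  have h_lower : ∀ x ∈ Set.Icc v 1, ε ^ 2 ≤ f (ε ^ 2 * x) := by
    intro x hx
    by_contra! hlt
    obtain ⟨z, hz, hgz⟩ := intermediate_value_Icc' hx.1
      (hg.mono (Set.Icc_subset_Icc (by linarith) hx.2))
      (show f (ε ^ 2) ∈ Set.Icc (f (ε ^ 2 * x)) (f (ε ^ 2 * v)) from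
        ⟨hlt.le.trans h_end, hgv ▸ hfe.le⟩)
    dsimp only at hgz
    have hz1 : z ≤ 1 := hz.2.trans hx.2
    have hfz : f z = f 1 := by
      have h := hfks z ⟨by linarith [hz.1], hz1⟩
      have h' := hfks 1 (by simp)
      rw [mul_one, ← hgz, h] at h'
      exact mul_left_cancel₀ hε0.ne' h'
    have hz_eq : z = 1 := hinc.injOn ⟨hz.1, hz1⟩ ⟨hv.le, le_rfl⟩ hfz
    have hx1 : x = 1 := le_antisymm hx.2 (hz_eq ▸ hz.2)
    rw [hx1, mul_one] at hlt
    linarith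
  rintro _ ⟨t, ht, rfl⟩
  have htx : t = ε ^ 2 * (t / ε ^ 2) := by field_simp
  have hx : t / ε ^ 2 ∈ Set.Icc v 1 :=
    ⟨(le_div_iff₀ hε2).mpr (by linarith [ht.1]), (div_le_one hε2).mpr ht.2⟩
  rw [htx]
  exact ⟨h_lower _ hx, h_upper _ hx⟩
end

section
/- Let ε be a real number with 0 < ε < 1 and let f be a single-valley-extended solution of the second type of FKS equation with platform [u,v]. Then f is strictly monotone on the interval [ε²v, ε²] (strictly increasing or strictly decreasing there). -/
/-- f is strictly monotone (strictly increasing or strictly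
decreasing) on [ε²v, ε²]. -/
theorem stmt_12 (ε : ℝ) (hε0 : 0 < ε) (hε1 : ε < 1) (f : ℝ → ℝ)
    (hmap : Set.MapsTo f (Set.Icc 0 1) (Set.Icc 0 1))
    (hcont : ContinuousOn f (Set.Icc 0 1))
    (hf0 : f 0 = 1)
    (hfks : ∀ x ∈ Set.Icc (0:ℝ) 1, f (f (ε^2 * x)) = ε * f x)
    (u v : ℝ) (hu : ε^2 < u) (huv : u < v) (hv : v < 1)
    (hdec : StrictAntiOn f (Set.Icc (ε^2) u))
    (hplat : ∀ x ∈ Set.Icc u v, f x = 0)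
    (hinc : StrictMonoOn f (Set.Icc v 1))
    (hminset : {α | α ∈ Set.Icc (0:ℝ) 1 ∧ ∀ x ∈ Set.Icc (0:ℝ) 1, f α ≤ f x} = Set.Icc u v) :
    StrictMonoOn f (Set.Icc (ε^2 * v) (ε^2)) ∨ StrictAntiOn f (Set.Icc (ε^2 * v) (ε^2)) := by
  have hε2 : 0 < ε ^ 2 := by positivity
  have hε21 : ε ^ 2 < 1 := by nlinarith
  have hv0 : 0 < v := by linarith
  have hle : ε ^ 2 * v ≤ ε ^ 2 := by nlinarith
  have hsub : Set.Icc (ε ^ 2 * v) (ε ^ 2) ⊆ Set.Icc 0 1 := fun x hx =>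
    ⟨(mul_pos hε2 hv0).le.trans hx.1, hx.2.trans hε21.le⟩
  have hscale : ∀ x ∈ Set.Icc (ε ^ 2 * v) (ε ^ 2),
      x / ε ^ 2 ∈ Set.Icc v 1 ∧ f (f x) = ε * f (x / ε ^ 2) := by
    intro x hx
    have hmem : x / ε ^ 2 ∈ Set.Icc v 1 :=
      ⟨(le_div_iff₀' hε2).2 hx.1, (div_le_one hε2).2 hx.2⟩
    have h := hfks (x / ε ^ 2) ⟨hv0.le.trans hmem.1, hmem.2⟩
    rw [mul_div_cancel₀ x hε2.ne'] at h
    exact ⟨hmem, h⟩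
  refine ContinuousOn.strictMonoOn_of_injOn_Icc' hle (hcont.mono hsub) ?_
  intro x hx y hy hxy
  obtain ⟨hx', hfx⟩ := hscale x hx
  obtain ⟨hy', hfy⟩ := hscale y hy
  have h : ε * f (x / ε ^ 2) = ε * f (y / ε ^ 2) := by rw [← hfx, ← hfy, hxy]
  exact (div_left_inj' hε2.ne').1 (hinc.injOn hx' hy' (mul_left_cancel₀ hε0.ne' h))
end

section
/- Let ε be a real number with 0 < ε < 1 and let f be a single-valley-extended solution of the second type of FKS equation with platform [u,v]. If f(ε²) > v, then for every integer n ≥ 0, f is strictly increasing on the interval [ε^{2n} v, ε^{2n}] and strictly decreasing on the interval [ε^{2n+2}, ε^{2n} u]. -/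
/-- If f(ε²) > v, then for every n ≥ 0, f is strictly increasing
on [ε^(2n) v, ε^(2n)] and strictly decreasing on [ε^(2n+2), ε^(2n) u]. -/
theorem stmt_13 (ε : ℝ) (hε0 : 0 < ε) (hε1 : ε < 1) (f : ℝ → ℝ)
    (hmap : Set.MapsTo f (Set.Icc 0 1) (Set.Icc 0 1))
    (hcont : ContinuousOn f (Set.Icc 0 1))
    (hf0 : f 0 = 1)
    (hfks : ∀ x ∈ Set.Icc (0:ℝ) 1, f (f (ε^2 * x)) = ε * f x)
    (u v : ℝ) (hu : ε^2 < u) (huv : u < v) (hv : v < 1)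
    (hdec : StrictAntiOn f (Set.Icc (ε^2) u))
    (hplat : ∀ x ∈ Set.Icc u v, f x = 0)
    (hinc : StrictMonoOn f (Set.Icc v 1))
    (hminset : {α | α ∈ Set.Icc (0:ℝ) 1 ∧ ∀ x ∈ Set.Icc (0:ℝ) 1, f α ≤ f x} = Set.Icc u v)
    (hfe : v < f (ε^2)) :
    ∀ n : ℕ, StrictMonoOn f (Set.Icc (ε^(2*n) * v) (ε^(2*n))) ∧
      StrictAntiOn f (Set.Icc (ε^(2*n+2)) (ε^(2*n) * u)) := by
  have hq0 : 0 < ε ^ 2 := by positivity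
  have hq1 : ε ^ 2 < 1 := by nlinarith
  have hu0 : 0 < u := hq0.trans hu
  have hscale : ∀ x ∈ Set.Icc (0 : ℝ) 1, ε ^ 2 * x ∈ Set.Icc (0 : ℝ) 1 := fun x hx =>
    ⟨mul_nonneg hq0.le hx.1, by nlinarith [hx.1, hx.2]⟩
  have hgcont : ContinuousOn (fun x => f (ε ^ 2 * x)) (Set.Icc 0 1) :=
    hcont.comp (by fun_prop) hscale
  have hpre : ∀ t ∈ Set.Icc (0 : ℝ) 1, f (ε ^ 2 * t) = v → t ∈ Set.Icc u v := by
    intro t ht h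
    have h1 := hfks t ht
    rw [h, hplat v ⟨huv.le, le_rfl⟩] at h1
    have h2 : f t = 0 := by
      rcases mul_eq_zero.mp h1.symm with h | h
      · exact absurd h hε0.ne'
      · exact h
    rw [← hminset]
    exact ⟨ht, fun x hx => by rw [h2]; exact (hmap hx).1⟩
  have hleft : ∀ x ∈ Set.Icc (0 : ℝ) 1, x ≤ u → v ≤ f (ε ^ 2 * x) := by
    intro x hx hxu
    by_contra! hlt
    obtain ⟨t, ht, hft⟩ := intermediate_value_Icc' hx.1
      (hgcont.mono (Set.Icc_subset_Icc le_rfl hx.2))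
      (show v ∈ Set.Icc (f (ε ^ 2 * x)) (f (ε ^ 2 * 0)) from
        ⟨hlt.le, by rw [mul_zero, hf0]; exact hv.le⟩)
    have htx : t = x :=
      le_antisymm ht.2 (hxu.trans (hpre t ⟨ht.1, ht.2.trans hx.2⟩ hft).1)
    subst htx
    exact hlt.ne hft
  have hright : ∀ x ∈ Set.Icc (0 : ℝ) 1, v ≤ x → v ≤ f (ε ^ 2 * x) := by
    intro x hx hxv
    by_contra! hlt
    obtain ⟨t, ht, hft⟩ := intermediate_value_Icc hx.2
      (hgcont.mono (Set.Icc_subset_Icc hx.1 le_rfl))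
      (show v ∈ Set.Icc (f (ε ^ 2 * x)) (f (ε ^ 2 * 1)) from
        ⟨hlt.le, by rw [mul_one]; exact hfe.le⟩)
    have htx : t = x :=
      le_antisymm ((hpre t ⟨hx.1.trans ht.1, ht.2⟩ hft).2.trans hxv) ht.1
    subst htx
    exact hlt.ne hft
  -- Where `f (ε² x) ≥ v`, the equation transfers order from `f x` to `f (ε² x)`.
  have hlift : ∀ x ∈ Set.Icc (0 : ℝ) 1, ∀ y ∈ Set.Icc (0 : ℝ) 1, v ≤ f (ε ^ 2 * x) →
      v ≤ f (ε ^ 2 * y) → f x < f y → f (ε ^ 2 * x) < f (ε ^ 2 * y) := by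
    intro x hx y hy hvx hvy hxy
    refine (hinc.lt_iff_lt ⟨hvx, (hmap (hscale x hx)).2⟩ ⟨hvy, (hmap (hscale y hy)).2⟩).mp ?_
    rw [hfks x hx, hfks y hy]
    exact mul_lt_mul_of_pos_left hxy hε0
  have hdiv : ∀ {a b x : ℝ}, x ∈ Set.Icc (ε ^ 2 * a) (ε ^ 2 * b) →
      ∃ z ∈ Set.Icc a b, x = ε ^ 2 * z := by
    intro a b x hx
    refine ⟨x / ε ^ 2, ⟨?_, ?_⟩, by field_simp⟩
    · rw [le_div_iff₀ hq0]; linarith [hx.1]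
    · rw [div_le_iff₀ hq0]; linarith [hx.2]
  intro n
  induction n with
  | zero => simpa using ⟨hinc, hdec⟩
  | succ n ih =>
    have hp0 : 0 < ε ^ (2 * n) := by positivity
    have hp1 : ε ^ (2 * n) ≤ 1 := pow_le_one₀ hε0.le hε1.le
    constructor
    · have hgood : ∀ z ∈ Set.Icc (ε ^ (2 * n) * v) (ε ^ (2 * n)),
          z ∈ Set.Icc (0 : ℝ) 1 ∧ v ≤ f (ε ^ 2 * z) := by
        intro z hz
        have hz01 : z ∈ Set.Icc (0 : ℝ) 1 :=
          ⟨(mul_nonneg hp0.le (hu0.trans huv).le).trans hz.1, hz.2.trans hp1⟩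
        refine ⟨hz01, ?_⟩
        rcases Nat.eq_zero_or_pos n with rfl | hn
        · exact hright z hz01 (by simpa using hz.1)
        · exact hleft z hz01 (hz.2.trans
            ((pow_le_pow_of_le_one hε0.le hε1.le (by omega)).trans hu.le))
      intro x hx y hy hxy
      rw [show ε ^ (2 * (n + 1)) * v = ε ^ 2 * (ε ^ (2 * n) * v) by ring,
        show ε ^ (2 * (n + 1)) = ε ^ 2 * ε ^ (2 * n) by ring] at hx hy
      obtain ⟨x, hx', rfl⟩ := hdiv hx
      obtain ⟨y, hy', rfl⟩ := hdiv hy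
      exact hlift x (hgood x hx').1 y (hgood y hy').1 (hgood x hx').2 (hgood y hy').2
        (ih.1 hx' hy' (lt_of_mul_lt_mul_left hxy hq0.le))
    · have hgood : ∀ z ∈ Set.Icc (ε ^ (2 * n + 2)) (ε ^ (2 * n) * u),
          z ∈ Set.Icc (0 : ℝ) 1 ∧ v ≤ f (ε ^ 2 * z) := by
        intro z hz
        have hzu : z ≤ u := hz.2.trans (mul_le_of_le_one_left hu0.le hp1)
        have hz01 : z ∈ Set.Icc (0 : ℝ) 1 :=
          ⟨(by positivity : 0 ≤ ε ^ (2 * n + 2)).trans hz.1, by linarith⟩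
        exact ⟨hz01, hleft z hz01 hzu⟩
      intro x hx y hy hxy
      rw [show ε ^ (2 * (n + 1) + 2) = ε ^ 2 * ε ^ (2 * n + 2) by ring,
        show ε ^ (2 * (n + 1)) * u = ε ^ 2 * (ε ^ (2 * n) * u) by ring] at hx hy
      obtain ⟨x, hx', rfl⟩ := hdiv hx
      obtain ⟨y, hy', rfl⟩ := hdiv hy
      exact hlift y (hgood y hy').1 x (hgood x hx').1 (hgood y hy').2 (hgood x hx').2
        (ih.2 hx' hy' (lt_of_mul_lt_mul_left hxy hq0.le))
end

section
/- Let ε be a real number with 0 < ε < 1 and let a, u, v be real numbers with ε² ≤ a < u < v < 1. Let q : [ε², u] → [0, a] be a strictly decreasing continuous surjection with q(ε²) = a, q(a) = ε², q(u) = 0; let p : [v, 1] → [0, ε] be a strictly increasing continuous surjection with p(v) = 0, p(1) = ε, such that the only solution of p(x) = εx with x ∈ [v,1] is x = 1; and let h : [ε²u, ε²v] → [u, v] be a continuous function with h(ε²v) = u and h(ε²u) = v. Then there exists a single-valley-extended solution f of the second type of FKS equation with platform [u,v] such that f(x) = q(x) for all x ∈ [ε², u], f(x) = 0 for all x ∈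 [u, v], f(x) = p(x) for all x ∈ [v, 1], and f(x) = h(x) for all x ∈ [ε²u, ε²v]. -/
open Set Filter Topology

/-- A strictly increasing map of `[a, b]` onto `[c, d]` has a continuous monotone right inverse on
`[c, d]`, defined on the whole line. -/
lemma StrictMonoOn.exists_continuous_monotone_rightInverse {f : ℝ → ℝ} {a b c d : ℝ}
    (hcd : c ≤ d) (hf : StrictMonoOn f (Icc a b)) (hs : f '' Icc a b = Icc c d) :
    ∃ g : ℝ → ℝ, Continuous g ∧ Monotone g ∧ (∀ t, g t ∈ Icc a b) ∧
      ∀ t ∈ Icc c d, f (g t) = t := by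
  let e : Icc a b ≃o Icc c d := (hf.orderIso f (Icc a b)).trans (OrderIso.setCongr _ _ hs)
  have he : ∀ x, (e x : ℝ) = f x := fun x => rfl
  refine ⟨IccExtend hcd (fun t => (e.symm t : ℝ)), ?_, ?_, fun t => (e.symm _).2, ?_⟩
  · exact (continuous_subtype_val.comp e.symm.continuous).Icc_extend'
  · exact Monotone.IccExtend hcd fun x y hxy => e.symm.monotone hxy
  · intro t ht
    rw [IccExtend_of_mem _ _ ht, ← he, e.apply_symm_apply]

/-- A strictly decreasing map of `[a, b]` onto `[c, d]` has a continuous antitone right inverse on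
`[c, d]`, defined on the whole line. -/
lemma StrictAntiOn.exists_continuous_antitone_rightInverse {f : ℝ → ℝ} {a b c d : ℝ}
    (hcd : c ≤ d) (hf : StrictAntiOn f (Icc a b)) (hs : f '' Icc a b = Icc c d) :
    ∃ g : ℝ → ℝ, Continuous g ∧ Antitone g ∧ (∀ t, g t ∈ Icc a b) ∧
      ∀ t ∈ Icc c d, f (g t) = t := by
  have hs' : (fun x => -f x) '' Icc a b = Icc (-d) (-c) := by
    rw [← image_neg_Icc, ← hs, image_image]
  obtain ⟨g, hgc, hgm, hg, hfg⟩ :=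
    StrictMonoOn.exists_continuous_monotone_rightInverse (neg_le_neg hcd) hf.neg hs'
  refine ⟨fun t => g (-t), hgc.comp continuous_neg, fun x y hxy => hgm (neg_le_neg hxy),
    fun t => hg _, fun t ht => ?_⟩
  have := hfg (-t) ⟨neg_le_neg ht.2, neg_le_neg ht.1⟩
  exact neg_injective this

/-- A continuous function on `[a, b]` extends to the line by constants. -/
lemma ContinuousOn.exists_continuous_const_extension {f : ℝ → ℝ} {a b : ℝ} (hab : a ≤ b)
    (hf : ContinuousOn f (Icc a b)) :
    ∃ F : ℝ → ℝ, Continuous F ∧ (∀ x ∈ Icc a b, F x = f x) ∧ (∀ x, x ≤ a → F x = f a) ∧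
      ∀ x, b ≤ x → F x = f b :=
  ⟨IccExtend hab ((Icc a b).domRestrict f), hf.domRestrict.Icc_extend',
    fun _ hx => IccExtend_of_mem _ _ hx, fun _ hx => IccExtend_of_le_left _ _ hx,
    fun _ hx => IccExtend_of_right_le _ _ hx⟩

/-- A function on `[c, ∞)` that is compatible at `c` with the equation `f x = g (f (x / l))`
extends to a continuous function on the line satisfying this equation on `[0, c]`, provided the
iterates of `g` converge to `1`. -/
lemma exists_continuous_extension_of_iterate_tendsto {l c : ℝ} {b g : ℝ → ℝ}
    (hl0 : 0 < l) (hl1 : l < 1) (hc : 0 < c) (hb : Continuous b) (hb01 : ∀ x, b x ∈ Icc (0 : ℝ) 1)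
    (hg : Continuous g) (hgm : Monotone g) (hg0 : 0 ≤ g 0) (hg1 : g 1 = 1)
    (hbc : b c = g (b (c / l))) (hlim : Tendsto (fun n => g^[n] 0) atTop (𝓝 1)) :
    ∃ f : ℝ → ℝ, Continuous f ∧ f 0 = 1 ∧ (∀ x, f x ∈ Icc (0 : ℝ) 1) ∧
      (∀ x, c ≤ x → f x = b x) ∧ ∀ x, x ≤ c → f x = g (f (x / l)) := by
  have hdiv : ∀ x, 0 < x → x ≤ x / l := fun x hx => by
    rw [le_div_iff₀ hl0]; nlinarith
  obtain ⟨F, hF0, hFs⟩ : ∃ F : ℕ → ℝ → ℝ, F 0 = b ∧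
      ∀ n x, F (n + 1) x = if x ≤ c then g (F n (x / l)) else b x :=
    ⟨fun n => Nat.rec b (fun _ G x => if x ≤ c then g (G (x / l)) else b x) n, rfl,
      fun _ _ => rfl⟩
  have hFb : ∀ n x, c ≤ x → F n x = b x := by
    intro n
    induction n with
    | zero => intro x _; rw [hF0]
    | succ n ih =>
      intro x hx
      rw [hFs]
      split_ifs with h
      · obtain rfl : x = c := le_antisymm h hx
        rw [ih _ (hdiv x hc), hbc]
      · rfl
  have hFc : ∀ n, Continuous (F n) := by
    intro n
    induction n with
    | zero => rwa [hF0]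
    | succ n ih =>
      rw [funext (hFs n)]
      refine Continuous.if_le (f := fun x => x) (g := fun _ => c)
        (hg.comp (ih.comp (continuous_id.div_const l))) hb continuous_id continuous_const ?_
      rintro x rfl
      rw [hFb n _ (hdiv x hc), hbc]
  have hF01 : ∀ n x, F n x ∈ Icc (0 : ℝ) 1 := by
    intro n
    induction n with
    | zero => rwa [hF0]
    | succ n ih =>
      intro x
      rw [hFs]
      split_ifs
      · exact ⟨hg0.trans (hgm (ih _).1), (hgm (ih _).2).trans_eq hg1⟩
      · exact hb01 x
  have hFstep : ∀ n x, c * l ^ n ≤ x → F (n + 1) x = F n x := by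
    intro n
    induction n with
    | zero => intro x hx; rw [hFb (0 + 1) x (by simpa using hx), hF0]
    | succ n ih =>
      intro x hx
      rw [hFs (n + 1) x, hFs n x, ih (x / l)]
      rw [le_div_iff₀ hl0, mul_assoc, ← pow_succ]
      exact hx
  have hFeq : ∀ n m x, n ≤ m → c * l ^ n ≤ x → F m x = F n x := by
    intro n m x hnm hx
    induction m, hnm using Nat.le_induction with
    | base => rfl
    | succ m hm ih =>
      rw [hFstep m x (le_trans _ hx), ih]
      exact mul_le_mul_of_nonneg_left (pow_le_pow_of_le_one hl0.le hl1.le hm) hc.le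
  have hN : ∀ x, ∃ n : ℕ, 0 < x → c * l ^ n < x := by
    intro x
    by_cases hx : 0 < x
    · obtain ⟨n, hn⟩ := exists_pow_lt_of_lt_one (div_pos hx hc) hl1
      exact ⟨n, fun _ => by rw [lt_div_iff₀ hc] at hn; linarith⟩
    · exact ⟨0, fun h => absurd h hx⟩
  choose N hN using hN
  let f : ℝ → ℝ := fun x => if 0 < x then F (N x) x else 1
  have hpos : ∀ n : ℕ, 0 < c * l ^ n := fun n => mul_pos hc (pow_pos hl0 n)
  have hfneg : ∀ x, x ≤ 0 → f x = 1 := fun x hx => if_neg hx.not_gt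
  have hfF : ∀ n x, c * l ^ n ≤ x → f x = F n x := by
    intro n x hx
    have hx0 : 0 < x := (hpos n).trans_le hx
    have h1 : f x = F (N x) x := if_pos hx0
    rw [h1, ← hFeq _ (max n (N x)) x (le_max_right _ _) (hN x hx0).le,
      ← hFeq n (max n (N x)) x (le_max_left _ _) hx]
  have hf01 : ∀ x, f x ∈ Icc (0 : ℝ) 1 := by
    intro x
    simp only [f]
    split_ifs
    · exact hF01 _ _
    · simp
  have hfeq : ∀ x, x ≤ c → f x = g (f (x / l)) := by
    intro x hxc
    rcases le_or_gt x 0 with hx | hx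
    · rw [hfneg x hx, hfneg _ (div_nonpos_of_nonpos_of_nonneg hx hl0.le), hg1]
    · have hn := (hN x hx).le
      have h2 : c * l ^ (N x + 1) ≤ x := by
        rw [pow_succ, ← mul_assoc]
        exact (mul_le_of_le_one_right (hpos _).le hl1.le).trans hn
      rw [hfF _ x h2, hFs, if_pos hxc, hfF (N x) (x / l) (hn.trans (hdiv x hx))]
  have hlow : ∀ n x, x ≤ c * l ^ n → g^[n] 0 ≤ f x := by
    intro n
    induction n with
    | zero => intro x _; exact (hf01 x).1
    | succ n ih =>
      intro x hx
      rw [Function.iterate_succ_apply', hfeq x]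
      · refine hgm (ih _ ?_)
        rwa [div_le_iff₀ hl0, mul_assoc, ← pow_succ]
      · exact hx.trans (mul_le_of_le_one_right hc.le (pow_le_one₀ hl0.le hl1.le))
  refine ⟨f, ?_, hfneg 0 le_rfl, hf01, fun x hx => ?_, hfeq⟩
  · rw [continuous_iff_continuousAt]
    intro x
    rcases le_or_gt x 0 with hx | hx
    · rw [ContinuousAt, hfneg x hx, tendsto_order]
      refine ⟨fun y hy => ?_, fun y hy => Eventually.of_forall fun z => (hf01 z).2.trans_lt hy⟩
      obtain ⟨n, hn⟩ := (hlim.eventually (lt_mem_nhds hy)).exists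
      filter_upwards [Iio_mem_nhds (hx.trans_lt (hpos n))] with z hz
      exact hn.trans_le (hlow n z (le_of_lt hz))
    · refine (hFc (N x)).continuousAt.congr ?_
      filter_upwards [Ioi_mem_nhds (hN x hx)] with z hz
      exact (hfF _ z (le_of_lt hz)).symm
  · rw [hfF 0 x (by simpa using hx), hF0]

/-- The iterates of a continuous monotone self-map of `[0, 1]` whose only fixed point there is `1`
converge to `1`. -/
lemma tendsto_iterate_zero_of_unique_fixedPoint {g : ℝ → ℝ} (hg : Continuous g) (hgm : Monotone g)
    (hg01 : MapsTo g (Icc 0 1) (Icc 0 1)) (hfix : ∀ x ∈ Icc (0 : ℝ) 1, g x = x → x = 1) :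
    Tendsto (fun n => g^[n] 0) atTop (𝓝 1) := by
  have h01 : ∀ n, g^[n] 0 ∈ Icc (0 : ℝ) 1 := fun n => hg01.iterate n (by simp)
  have hlim := tendsto_atTop_ciSup (hgm.monotone_iterate_of_le_map (hg01 (x := 0) (by simp)).1)
    ⟨1, by rintro _ ⟨n, rfl⟩; exact (h01 n).2⟩
  have hmem := isClosed_Icc.mem_of_tendsto hlim (Eventually.of_forall h01)
  have := hfix _ hmem (isFixedPt_of_tendsto_iterate hlim hg.continuousAt)
  rwa [this] at hlim


/-- Construction of single-valley-extended solutions with platforms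
(case ε² ≤ a < u): from data q, p, h as described, there exists a
single-valley-extended solution f of the second type of FKS equation with
platform [u,v] extending q, p, h and vanishing on [u,v]. -/
theorem stmt_15 (ε : ℝ) (hε0 : 0 < ε) (hε1 : ε < 1)
    (a u v : ℝ) (ha : ε^2 ≤ a) (hau : a < u) (huv : u < v) (hv : v < 1)
    (q : ℝ → ℝ)
    (hq_anti : StrictAntiOn q (Set.Icc (ε^2) u))
    (hq_cont : ContinuousOn q (Set.Icc (ε^2) u))
    (hq_surj : q '' Set.Icc (ε^2) u = Set.Icc 0 a)
    (hq1 : q (ε^2) = a) (hq2 : q a = ε^2) (hq3 : q u = 0)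
    (p : ℝ → ℝ)
    (hp_mono : StrictMonoOn p (Set.Icc v 1))
    (hp_cont : ContinuousOn p (Set.Icc v 1))
    (hp_surj : p '' Set.Icc v 1 = Set.Icc 0 ε)
    (hp1 : p v = 0) (hp2 : p 1 = ε)
    (hp_fix : ∀ x ∈ Set.Icc v 1, (p x = ε * x ↔ x = 1))
    (h : ℝ → ℝ)
    (hh_cont : ContinuousOn h (Set.Icc (ε^2 * u) (ε^2 * v)))
    (hh_map : Set.MapsTo h (Set.Icc (ε^2 * u) (ε^2 * v)) (Set.Icc u v))
    (hh1 : h (ε^2 * v) = u) (hh2 : h (ε^2 * u) = v) :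
    ∃ f : ℝ → ℝ,
      Set.MapsTo f (Set.Icc 0 1) (Set.Icc 0 1) ∧
      ContinuousOn f (Set.Icc 0 1) ∧
      f 0 = 1 ∧
      (∀ x ∈ Set.Icc (0:ℝ) 1, f (f (ε^2 * x)) = ε * f x) ∧
      StrictAntiOn f (Set.Icc (ε^2) u) ∧
      (∀ x ∈ Set.Icc u v, f x = 0) ∧
      StrictMonoOn f (Set.Icc v 1) ∧
      ({α | α ∈ Set.Icc (0:ℝ) 1 ∧ ∀ x ∈ Set.Icc (0:ℝ) 1, f α ≤ f x} = Set.Icc u v) ∧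
      (∀ x ∈ Set.Icc (ε^2) u, f x = q x) ∧
      (∀ x ∈ Set.Icc v 1, f x = p x) ∧
      (∀ x ∈ Set.Icc (ε^2 * u) (ε^2 * v), f x = h x) := by
  have hl0 : 0 < ε ^ 2 := by positivity
  have hl1 : ε ^ 2 < 1 := by nlinarith
  have ha0 : 0 < a := hl0.trans_le ha
  have hu0 : 0 < u := ha0.trans hau
  have hv0 : 0 < v := hu0.trans huv
  have hlu : ε ^ 2 ≤ u := ha.trans hau.le
  have huv' : ε ^ 2 * u ≤ ε ^ 2 * v := mul_le_mul_of_nonneg_left huv.le hl0.le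
  have hlv1 : ε ^ 2 * v ≤ ε ^ 2 := mul_le_of_le_one_right hl0.le hv.le
  have hqmem : ∀ x ∈ Icc (ε ^ 2) u, q x ∈ Icc 0 a := fun x hx =>
    hq_surj ▸ mem_image_of_mem q hx
  have hpmem : ∀ x ∈ Icc v 1, p x ∈ Icc 0 ε := fun x hx => hp_surj ▸ mem_image_of_mem p hx
  obtain ⟨s, hsc, hsm, hs, hps⟩ :=
    hp_mono.exists_continuous_monotone_rightInverse hε0.le hp_surj
  obtain ⟨r, hrc, hrm, hr, hqr⟩ :=
    hq_anti.exists_continuous_antitone_rightInverse ha0.le hq_surj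
  have hr0 : r 0 = u := hq_anti.injOn (hr 0) ⟨hlu, le_rfl⟩ (by rw [hqr 0 ⟨le_rfl, ha0.le⟩, hq3])
  have hr1 : r (ε ^ 2) = a :=
    hq_anti.injOn (hr _) ⟨ha, hau.le⟩ (by rw [hqr _ ⟨hl0.le, ha⟩, hq2])
  have hs0 : s 0 = v := hp_mono.injOn (hs 0) ⟨le_rfl, hv.le⟩ (by rw [hps 0 ⟨le_rfl, hε0.le⟩, hp1])
  have hs1 : s ε = 1 := hp_mono.injOn (hs ε) ⟨hv.le, le_rfl⟩ (by rw [hps ε ⟨hε0.le, le_rfl⟩, hp2])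
  -- continuous extensions of the data by constants
  obtain ⟨Q, hQc, hQ, hQl, hQr⟩ := hq_cont.exists_continuous_const_extension hlu
  obtain ⟨P, hPc, hP, hPl, hPr⟩ := hp_cont.exists_continuous_const_extension hv.le
  obtain ⟨H, hHc, hH, hHl, hHr⟩ := hh_cont.exists_continuous_const_extension huv'
  rw [hq1] at hQl
  rw [hq3] at hQr
  rw [hp1] at hPl
  rw [hp2] at hPr
  rw [hh2] at hHl
  rw [hh1] at hHr
  have hPmem : ∀ x, P x ∈ Icc 0 ε := by
    intro x
    rcases le_total x v with hx | hx
    · rw [hPl x hx]; exact ⟨le_rfl, hε0.le⟩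
    rcases le_total x 1 with hx1 | hx1
    · rw [hP x ⟨hx, hx1⟩]; exact hpmem x ⟨hx, hx1⟩
    · rw [hPr x hx1]; exact ⟨hε0.le, le_rfl⟩
  have hQmem : ∀ x, Q x ∈ Icc 0 a := by
    intro x
    rcases le_total x (ε ^ 2) with hx | hx
    · rw [hQl x hx]; exact ⟨ha0.le, le_rfl⟩
    rcases le_total x u with hx1 | hx1
    · rw [hQ x ⟨hx, hx1⟩]; exact hqmem x ⟨hx, hx1⟩
    · rw [hQr x hx1]; exact ⟨le_rfl, ha0.le⟩
  have hHmem : ∀ x, H x ∈ Icc u v := by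
    intro x
    rcases le_total x (ε ^ 2 * u) with hx | hx
    · rw [hHl x hx]; exact ⟨huv.le, le_rfl⟩
    rcases le_total x (ε ^ 2 * v) with hx1 | hx1
    · rw [hH x ⟨hx, hx1⟩]; exact hh_map ⟨hx, hx1⟩
    · rw [hHr x hx1]; exact ⟨le_rfl, huv.le⟩
  have hrmem : ∀ x, r (ε * P x) ∈ Icc a u := by
    intro x
    have h1 := hPmem x
    constructor
    · rw [← hr1]; exact hrm (by nlinarith [h1.2])
    · exact (hr _).2
  obtain ⟨b, hbdef⟩ : ∃ b : ℝ → ℝ, b = fun x =>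
    if x ≤ ε ^ 2 then H x + r (ε * P (x / ε ^ 2)) - u else Q x + P x := ⟨_, rfl⟩
  have hbl : ∀ x, x ≤ ε ^ 2 → b x = H x + r (ε * P (x / ε ^ 2)) - u := fun x hx => by
    simp [hbdef, hx]
  have hbjoin : H (ε ^ 2) + r (ε * P (ε ^ 2 / ε ^ 2)) - u = Q (ε ^ 2) + P (ε ^ 2) := by
    rw [div_self hl0.ne', hPr 1 le_rfl, ← pow_two, hr1, hHr _ hlv1, hQl _ le_rfl,
      hPl _ (hlu.trans huv.le)]
    ring
  have hbr : ∀ x, ε ^ 2 ≤ x → b x = Q x + P x := by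
    intro x hx
    rcases hx.eq_or_lt with rfl | hx
    · rw [hbl _ le_rfl, hbjoin]
    · simp [hbdef, hx.not_ge]
  have hblH : ∀ x, x ≤ ε ^ 2 * v → b x = H x := by
    intro x hx
    rw [hbl x (hx.trans hlv1), hPl, mul_zero, hr0]
    · ring
    · rwa [div_le_iff₀ hl0, mul_comm]
  have hblr : ∀ x, ε ^ 2 * v ≤ x → x ≤ ε ^ 2 → b x = r (ε * P (x / ε ^ 2)) := by
    intro x hx hx1
    rw [hbl x hx1, hHr x hx]
    ring
  have hblow : ∀ x, x ≤ ε ^ 2 → b x ∈ Icc a 1 := by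
    intro x hx
    rcases le_total x (ε ^ 2 * v) with hx1 | hx1
    · rw [hblH x hx1]; exact ⟨hau.le.trans (hHmem x).1, (hHmem x).2.trans hv.le⟩
    · rw [hblr x hx1 hx]; exact ⟨(hrmem _).1, (hrmem _).2.trans (huv.trans hv).le⟩
  have hbq : ∀ x ∈ Icc (ε ^ 2) u, b x = q x := fun x hx => by
    rw [hbr x hx.1, hQ x hx, hPl x (hx.2.trans huv.le), add_zero]
  have hbP : ∀ x, u ≤ x → b x = P x := fun x hx => by
    rw [hbr x (hlu.trans hx), hQr x hx, zero_add]
  have hbc : Continuous b := by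
    rw [hbdef]
    refine Continuous.if_le (by fun_prop) (by fun_prop) continuous_id continuous_const ?_
    rintro x rfl
    exact hbjoin
  have hb01 : ∀ x, b x ∈ Icc (0 : ℝ) 1 := by
    intro x
    rcases le_total x (ε ^ 2) with hx | hx
    · exact ⟨ha0.le.trans (hblow x hx).1, (hblow x hx).2⟩
    rcases le_total x u with hx1 | hx1
    · have := hqmem x ⟨hx, hx1⟩
      rw [hbq x ⟨hx, hx1⟩]
      exact ⟨this.1, by linarith [this.2]⟩
    · rw [hbP x hx1]
      exact ⟨(hPmem x).1, (hPmem x).2.trans hε1.le⟩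
  have hmulmem : ∀ x ∈ Icc (0 : ℝ) 1, ε * x ∈ Icc 0 ε := fun x hx =>
    ⟨mul_nonneg hε0.le hx.1, mul_le_of_le_one_right hε0.le hx.2⟩
  have hgc : Continuous fun t => s (ε * t) := by fun_prop
  have hgm : Monotone fun t => s (ε * t) := fun x y hxy =>
    hsm (mul_le_mul_of_nonneg_left hxy hε0.le)
  have hlim := tendsto_iterate_zero_of_unique_fixedPoint hgc hgm
    (fun x _ => ⟨hv0.le.trans (hs _).1, (hs _).2⟩) (fun x hx hsx => by
      have hsx' : s (ε * x) = x := hsx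
      have hxm := hs (ε * x)
      have hpx := hps _ (hmulmem x hx)
      rw [hsx'] at hxm hpx
      exact (hp_fix x hxm).1 hpx)
  obtain ⟨f, hfc, hf0, hf01, hfb, hfg⟩ := exists_continuous_extension_of_iterate_tendsto
    (c := ε ^ 2 * u) hl0 hl1 (mul_pos hl0 hu0) hbc hb01 hgc hgm
    (hv0.le.trans (hs _).1) (by rw [mul_one, hs1])
    (by rw [hblH _ huv', hHl _ le_rfl, mul_div_cancel_left₀ _ hl0.ne', hbP u le_rfl,
          hPl u huv.le, mul_zero, hs0]) hlim
  have hlul : ε ^ 2 * u ≤ ε ^ 2 := huv'.trans hlv1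
  have hfq : ∀ x ∈ Icc (ε ^ 2) u, f x = q x := fun x hx => by
    rw [hfb x (hlul.trans hx.1), hbq x hx]
  have hfP : ∀ x, u ≤ x → f x = P x := fun x hx => by
    rw [hfb x (hlul.trans (hlu.trans hx)), hbP x hx]
  have hf0uv : ∀ x ∈ Icc u v, f x = 0 := fun x hx => by rw [hfP x hx.1, hPl x hx.2]
  have hfp : ∀ x ∈ Icc v 1, f x = p x := fun x hx => by
    rw [hfP x (huv.le.trans hx.1), hP x hx]
  have hfh : ∀ x ∈ Icc (ε ^ 2 * u) (ε ^ 2 * v), f x = h x := fun x hx => by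
    rw [hfb x hx.1, hblH x hx.2, hH x hx]
  refine ⟨f, fun x _ => hf01 x, hfc.continuousOn, hf0, ?_, hq_anti.congr fun x hx => (hfq x hx).symm,
    hf0uv, hp_mono.congr fun x hx => (hfp x hx).symm, ?_, hfq, hfp, hfh⟩
  · intro x hx
    rcases le_total x u with hxu | hxu
    · rw [hfg (ε ^ 2 * x) (mul_le_mul_of_nonneg_left hxu hl0.le),
        mul_div_cancel_left₀ _ hl0.ne', hfp _ (hs _), hps _ (hmulmem _ (hf01 x))]
    have h1 : ε ^ 2 * u ≤ ε ^ 2 * x := mul_le_mul_of_nonneg_left hxu hl0.le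
    rcases le_total x v with hxv | hxv
    · have h2 : ε ^ 2 * x ≤ ε ^ 2 * v := mul_le_mul_of_nonneg_left hxv hl0.le
      rw [hfh _ ⟨h1, h2⟩, hf0uv _ (hh_map ⟨h1, h2⟩), hf0uv x ⟨hxu, hxv⟩, mul_zero]
    · have hrx := hrmem x
      have hPx := hPmem x
      rw [hfb _ h1, hblr _ (mul_le_mul_of_nonneg_left hxv hl0.le)
        (mul_le_of_le_one_right hl0.le hx.2), mul_div_cancel_left₀ _ hl0.ne',
        hfq _ ⟨ha.trans hrx.1, hrx.2⟩, hqr, hfP x hxu]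
      exact ⟨mul_nonneg hε0.le hPx.1, by nlinarith [hPx.2]⟩
  · ext x
    constructor
    · rintro ⟨hx, hmin⟩
      have hfx : f x ≤ 0 := (hmin u ⟨hu0.le, (huv.trans hv).le⟩).trans_eq
        (hf0uv u ⟨le_rfl, huv.le⟩)
      by_contra hxuv
      refine hfx.not_gt ?_
      rcases lt_or_ge x u with hxu | hxu
      · rcases le_total x (ε ^ 2 * u) with h1 | h1
        · rw [hfg x h1]
          exact hv0.trans_le (hs _).1
        rcases le_total x (ε ^ 2) with h2 | h2
        · rw [hfb x h1]
          exact ha0.trans_le (hblow x h2).1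
        · rw [hfq x ⟨h2, hxu.le⟩, ← hq3]
          exact hq_anti ⟨h2, hxu.le⟩ ⟨hlu, le_rfl⟩ hxu
      · have hvx : v < x := not_le.1 fun h1 => hxuv ⟨hxu, h1⟩
        rw [hfp x ⟨hvx.le, hx.2⟩, ← hp1]
        exact hp_mono ⟨le_rfl, hv.le⟩ ⟨hvx.le, hx.2⟩ hvx
    · intro hx
      refine ⟨⟨hu0.le.trans hx.1, hx.2.trans hv.le⟩, fun y _ => ?_⟩
      rw [hf0uv x hx]
      exact (hf01 y).1
end

section
/- Let ε be a real number with 0 < ε < 1 and let f be a single-valley-extended solution of the second type of FKS equation with platform [u,v] satisfying ε² ≤ f(ε²) < u. Set a = f(ε²), and let q and p denote the restrictions of f to [ε², u] and to [v, 1] respectively. Then: q is a strictly decreasing continuous surjection from [ε², u] onto [0, a] with q(ε²) = a, q(a) = ε² and q(u) = 0; p is a strictly increasing continuous surjection from [v, 1] onto [0, ε] with p(v) = 0 and p(1) = ε, and the only solution of p(x) = εx with x ∈ [v,1] is x = 1; moreover, for every x ∈ [ε²v, ε²], f(x) lies in [ε², u] and q(f(x)) = ε p(x/ε²); for every x ∈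 [ε⁴, ε²u], f(x) lies in [v, 1] and p(f(x)) = ε q(x/ε²); and for every integer k ≥ 2 and every x ∈ [ε^{2k+2}, ε^{2k}], f(x) lies in [v, 1] and p(f(x)) = ε f(x/ε²). -/
/-- Converse direction: a single-valley-extended solution with
platform [u,v] satisfying ε² ≤ f(ε²) < u has restrictions q = f|[ε²,u] and
p = f|[v,1] with the stated properties, and satisfies the recurrence relations. -/
theorem stmt_16 (ε : ℝ) (hε0 : 0 < ε) (hε1 : ε < 1) (f : ℝ → ℝ)
    (hmap : Set.MapsTo f (Set.Icc 0 1) (Set.Icc 0 1))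
    (hcont : ContinuousOn f (Set.Icc 0 1))
    (hf0 : f 0 = 1)
    (hfks : ∀ x ∈ Set.Icc (0:ℝ) 1, f (f (ε^2 * x)) = ε * f x)
    (u v : ℝ) (hu : ε^2 < u) (huv : u < v) (hv : v < 1)
    (hdec : StrictAntiOn f (Set.Icc (ε^2) u))
    (hplat : ∀ x ∈ Set.Icc u v, f x = 0)
    (hinc : StrictMonoOn f (Set.Icc v 1))
    (hminset : {α | α ∈ Set.Icc (0:ℝ) 1 ∧ ∀ x ∈ Set.Icc (0:ℝ) 1, f α ≤ f x} = Set.Icc u v)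
    (a : ℝ) (ha : a = f (ε^2)) (hage : ε^2 ≤ a) (halt : a < u) :
    (ContinuousOn f (Set.Icc (ε^2) u) ∧ StrictAntiOn f (Set.Icc (ε^2) u) ∧
      f '' Set.Icc (ε^2) u = Set.Icc 0 a ∧
      f (ε^2) = a ∧ f a = ε^2 ∧ f u = 0) ∧
    (ContinuousOn f (Set.Icc v 1) ∧ StrictMonoOn f (Set.Icc v 1) ∧
      f '' Set.Icc v 1 = Set.Icc 0 ε ∧
      f v = 0 ∧ f 1 = ε ∧
      (∀ x ∈ Set.Icc v 1, (f x = ε * x ↔ x = 1))) ∧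
    (∀ x ∈ Set.Icc (ε^2 * v) (ε^2),
      f x ∈ Set.Icc (ε^2) u ∧ f (f x) = ε * f (x / ε^2)) ∧
    (∀ x ∈ Set.Icc (ε^4) (ε^2 * u),
      f x ∈ Set.Icc v 1 ∧ f (f x) = ε * f (x / ε^2)) ∧
    (∀ k : ℕ, 2 ≤ k → ∀ x ∈ Set.Icc (ε^(2*k+2)) (ε^(2*k)),
      f x ∈ Set.Icc v 1 ∧ f (f x) = ε * f (x / ε^2)) := by
  have hsq0 : 0 < ε ^ 2 := by positivity
  have hsq1 : ε ^ 2 < 1 := pow_lt_one₀ hε0.le hε1 two_ne_zero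
  have hf1 : f 1 = ε := by simpa [hf0] using hfks 0 (by simp)
  have hfa : f a = ε ^ 2 := by
    have h := hfks 1 (by simp)
    rw [mul_one, ← ha, hf1] at h
    rw [h, sq]
  have hfu : f u = 0 := hplat u ⟨le_rfl, huv.le⟩
  have hfv : f v = 0 := hplat v ⟨huv.le, le_rfl⟩
  have hzero : ∀ x ∈ Set.Icc (0 : ℝ) 1, f x = 0 → x ∈ Set.Icc u v := by
    intro x hx h
    rw [← hminset]
    exact ⟨hx, fun y hy => h.le.trans (hmap hy).1⟩
  have hscale : Set.MapsTo (fun x => ε ^ 2 * x) (Set.Icc 0 1) (Set.Icc (0 : ℝ) 1) :=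
    fun x hx => ⟨mul_nonneg hsq0.le hx.1, mul_le_one₀ hsq1.le hx.1 hx.2⟩
  have hφc : ContinuousOn (fun x => f (ε ^ 2 * x)) (Set.Icc 0 1) :=
    hcont.comp (by fun_prop) hscale
  have hφz : ∀ x ∈ Set.Icc (0 : ℝ) 1, f (ε ^ 2 * x) ∈ Set.Icc u v → x ∈ Set.Icc u v := by
    intro x hx h
    have h1 := hfks x hx
    rw [hplat _ h] at h1
    exact hzero x hx ((mul_eq_zero.mp h1.symm).resolve_left hε0.ne')
  have hφ_left : ∀ y ∈ Set.Icc 0 u, f (ε ^ 2 * y) ∈ Set.Icc v 1 := by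
    intro y hy
    have hy1 : y ≤ 1 := by linarith [hy.2]
    refine ⟨?_, (hmap (hscale ⟨hy.1, hy1⟩)).2⟩
    by_contra! hlt
    obtain ⟨w, hw1, hw2⟩ := exists_between (max_lt hlt huv)
    obtain ⟨z, hz, hzw⟩ := intermediate_value_Icc' hy.1
      (hφc.mono (Set.Icc_subset_Icc_right hy1))
      (show w ∈ Set.Icc (f (ε ^ 2 * y)) (f (ε ^ 2 * 0)) by
        rw [mul_zero, hf0]
        exact ⟨((le_max_left _ _).trans_lt hw1).le, by linarith⟩)
    dsimp only at hzw
    have hzu := (hφz z ⟨hz.1, hz.2.trans hy1⟩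
      (hzw ▸ ⟨((le_max_right _ _).trans_lt hw1).le, hw2.le⟩)).1
    obtain rfl : z = y := le_antisymm hz.2 (hy.2.trans hzu)
    exact absurd ((le_max_left _ _).trans_lt hw1) (by rw [hzw]; exact lt_irrefl w)
  have hφ_right : ∀ y ∈ Set.Icc v 1, f (ε ^ 2 * y) ∈ Set.Icc (ε ^ 2) u := by
    intro y hy
    have hy0 : 0 ≤ y := by linarith [hy.1]
    constructor
    · refine hage.trans ?_
      by_contra! hlt
      have hφv : u ≤ f (ε ^ 2 * v) := by
        have hv01 : v ∈ Set.Icc (0 : ℝ) 1 := ⟨by linarith, hv.le⟩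
        refine (hzero _ (hmap (hscale hv01)) ?_).1
        rw [hfks v hv01, hfv, mul_zero]
      obtain ⟨z, hz, hza⟩ := intermediate_value_Icc' hy.1
        (hφc.mono (Set.Icc_subset_Icc (by linarith) hy.2))
        (show a ∈ Set.Icc (f (ε ^ 2 * y)) (f (ε ^ 2 * v)) from ⟨hlt.le, by linarith⟩)
      dsimp only at hza
      have h1 := hfks z ⟨by linarith [hz.1], hz.2.trans hy.2⟩
      rw [hza, hfa, sq] at h1
      have h2 : f z = f 1 := by rw [hf1]; exact (mul_left_cancel₀ hε0.ne' h1).symm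
      have hz1 : z = 1 := hinc.injOn ⟨hz.1, hz.2.trans hy.2⟩ ⟨hv.le, le_rfl⟩ h2
      obtain rfl : y = 1 := le_antisymm hy.2 (hz1 ▸ hz.2)
      rw [mul_one, ← ha] at hlt
      exact lt_irrefl _ hlt
    · by_contra! hlt
      obtain ⟨w, hw1, hw2⟩ := exists_between (lt_min hlt huv)
      obtain ⟨z, hz, hzw⟩ := intermediate_value_Icc' hy.2
        (hφc.mono (Set.Icc_subset_Icc_left hy0))
        (show w ∈ Set.Icc (f (ε ^ 2 * 1)) (f (ε ^ 2 * y)) by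
          rw [mul_one, ← ha]
          exact ⟨by linarith, (hw2.trans_le (min_le_left _ _)).le⟩)
      dsimp only at hzw
      have hzv := (hφz z ⟨hy0.trans hz.1, hz.2⟩
        (hzw ▸ ⟨hw1.le, (hw2.trans_le (min_le_right _ _)).le⟩)).2
      obtain rfl : z = y := le_antisymm (hzv.trans hy.1) hz.1
      exact absurd (hw2.trans_le (min_le_left _ _)) (by rw [hzw]; exact lt_irrefl w)
  have hleft : ∀ x, 0 ≤ x → x ≤ ε ^ 2 * u →
      f x ∈ Set.Icc v 1 ∧ f (f x) = ε * f (x / ε ^ 2) := by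
    intro x hx0 hxu
    have hxe : ε ^ 2 * (x / ε ^ 2) = x := mul_div_cancel₀ x hsq0.ne'
    have hx : x / ε ^ 2 ∈ Set.Icc 0 u := ⟨by positivity, (div_le_iff₀' hsq0).2 hxu⟩
    have h1 := hφ_left _ hx
    have h2 := hfks _ ⟨hx.1, by linarith [hx.2]⟩
    rw [hxe] at h1 h2
    exact ⟨h1, h2⟩
  have hcq : ContinuousOn f (Set.Icc (ε ^ 2) u) :=
    hcont.mono (Set.Icc_subset_Icc hsq0.le (by linarith))
  have hcp : ContinuousOn f (Set.Icc v 1) := hcont.mono (Set.Icc_subset_Icc_left (by linarith))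
  refine ⟨⟨hcq, hdec, ?_, ha.symm, hfa, hfu⟩, ⟨hcp, hinc, ?_, hfv, hf1, ?_⟩, ?_, ?_, ?_⟩
  · apply Set.Subset.antisymm
    · rintro _ ⟨x, hx, rfl⟩
      refine ⟨(hmap ⟨hsq0.le.trans hx.1, by linarith [hx.2]⟩).1, ?_⟩
      rw [ha]
      exact hdec.antitoneOn ⟨le_rfl, hu.le⟩ hx hx.1
    · simpa only [hfu, ← ha] using intermediate_value_Icc' hu.le hcq
  · apply Set.Subset.antisymm
    · rintro _ ⟨x, hx, rfl⟩
      refine ⟨(hmap ⟨by linarith [hx.1], hx.2⟩).1, ?_⟩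
      rw [← hf1]
      exact hinc.monotoneOn hx ⟨hv.le, le_rfl⟩ hx.2
    · simpa only [hfv, hf1] using intermediate_value_Icc hv.le hcp
  · intro x hx
    refine ⟨fun hfx => le_antisymm hx.2 ?_, fun h => by rw [h, hf1, mul_one]⟩
    have hmem : ∀ n : ℕ, (ε ^ 2) ^ n * u ∈ Set.Icc 0 u := fun n =>
      ⟨by have := hsq0.trans hu; positivity,
        mul_le_of_le_one_left (by linarith) (pow_le_one₀ hsq0.le hsq1.le)⟩
    have hbound : ∀ n : ℕ, f ((ε ^ 2) ^ n * u) ≤ x := by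
      intro n
      induction n with
      | zero => rw [pow_zero, one_mul, hfu]; linarith [hx.1]
      | succ n ih =>
        rw [pow_succ', mul_assoc, ← hinc.le_iff_le (hφ_left _ (hmem n)) hx,
          hfks _ ⟨(hmem n).1, by linarith [(hmem n).2]⟩, hfx]
        exact mul_le_mul_of_nonneg_left ih hε0.le
    have hlim : Filter.Tendsto (fun n : ℕ => (ε ^ 2) ^ n * u) Filter.atTop
        (nhdsWithin 0 (Set.Icc 0 1)) := by
      refine tendsto_nhdsWithin_iff.2 ⟨?_, Filter.Eventually.of_forall fun n =>
        ⟨(hmem n).1, by linarith [(hmem n).2]⟩⟩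
      simpa using (tendsto_pow_atTop_nhds_zero_of_lt_one hsq0.le hsq1).mul_const u
    have hflim := (hcont 0 (by simp)).tendsto.comp hlim
    rw [hf0] at hflim
    exact le_of_tendsto' hflim hbound
  · intro x hx
    have hxe : ε ^ 2 * (x / ε ^ 2) = x := mul_div_cancel₀ x hsq0.ne'
    have hy : x / ε ^ 2 ∈ Set.Icc v 1 :=
      ⟨(le_div_iff₀' hsq0).2 hx.1, (div_le_one hsq0).2 hx.2⟩
    have h1 := hφ_right _ hy
    have h2 := hfks _ ⟨by linarith [hy.1], hy.2⟩
    rw [hxe] at h1 h2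
    exact ⟨h1, h2⟩
  · exact fun x hx => hleft x ((by positivity : (0 : ℝ) ≤ ε ^ 4).trans hx.1) hx.2
  · intro k hk x hx
    refine hleft x ((by positivity : (0 : ℝ) ≤ ε ^ (2 * k + 2)).trans hx.1) (hx.2.trans ?_)
    calc ε ^ (2 * k) ≤ ε ^ 4 := pow_le_pow_of_le_one hε0.le hε1.le (by lia)
      _ = ε ^ 2 * ε ^ 2 := by ring
      _ ≤ ε ^ 2 * u := mul_le_mul_of_nonneg_left hu.le hsq0.le
end

section
/- Let ε be a real number with 0 < ε < 1 and let f be a single-valley-extended solution of the second type of FKS equation with platform [u,v] satisfying f(ε²) < u. Define g : [-1,1] → ℝ by g(x) = sgn(v - |x|) · f(|x|), where sgn denotes the sign function. Then g takes values in [-1,1], g is even (g(-x) = g(x) for all x ∈ [-1,1]), g(0) = 1, and g(g(ε²x)) = -ε g(x) for all x ∈ [-1,1]; that is, g is an even solution of the Feigenbaum–Kadanoff–Shenker equation. -/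
/-- A continuous function on an interval with values outside `Icc u v` stays on one side. -/
theorem lt_apply_of_avoids_Icc {h : ℝ → ℝ} {a b u v : ℝ} (huv : u ≤ v)
    (hc : ContinuousOn h (Set.uIcc a b)) (havoid : ∀ t ∈ Set.uIcc a b, h t ∉ Set.Icc u v)
    (ha : v < h a) : v < h b := by
  by_contra! hb
  obtain ⟨t, ht, htv⟩ := intermediate_value_uIcc hc (Set.mem_uIcc.2 (Or.inr ⟨hb, ha.le⟩))
  exact havoid t ht ⟨htv.symm ▸ huv, htv.le⟩

/-- If f is a single-valley-extended solution of the second type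
of FKS equation with platform [u,v] and f(ε²) < u, then
g(x) = sgn(v - |x|)·f(|x|) is an even solution of the FKS equation. -/
theorem stmt_17 (ε : ℝ) (hε0 : 0 < ε) (hε1 : ε < 1) (f : ℝ → ℝ)
    (hmap : Set.MapsTo f (Set.Icc 0 1) (Set.Icc 0 1))
    (hcont : ContinuousOn f (Set.Icc 0 1))
    (hf0 : f 0 = 1)
    (hfks : ∀ x ∈ Set.Icc (0:ℝ) 1, f (f (ε^2 * x)) = ε * f x)
    (u v : ℝ) (hu : ε^2 < u) (huv : u < v) (hv : v < 1)
    (hdec : StrictAntiOn f (Set.Icc (ε^2) u))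
    (hplat : ∀ x ∈ Set.Icc u v, f x = 0)
    (hinc : StrictMonoOn f (Set.Icc v 1))
    (hminset : {α | α ∈ Set.Icc (0:ℝ) 1 ∧ ∀ x ∈ Set.Icc (0:ℝ) 1, f α ≤ f x} = Set.Icc u v)
    (hfe : f (ε^2) < u)
    (g : ℝ → ℝ) (hg : ∀ x, g x = Real.sign (v - |x|) * f |x|) :
    (∀ x ∈ Set.Icc (-1:ℝ) 1, g x ∈ Set.Icc (-1:ℝ) 1) ∧
    (∀ x ∈ Set.Icc (-1:ℝ) 1, g (-x) = g x) ∧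
    g 0 = 1 ∧
    (∀ x ∈ Set.Icc (-1:ℝ) 1, g (g (ε^2 * x)) = -(ε * g x)) := by
  have hzero : ∀ x ∈ Set.Icc (0:ℝ) 1, f x = 0 → x ∈ Set.Icc u v := fun x hx h0 => by
    rw [← hminset]
    exact ⟨hx, fun y hy => h0 ▸ (hmap hy).1⟩
  have hε2 : 0 < ε ^ 2 := by positivity
  have hscale : ∀ x ∈ Set.Icc (0:ℝ) 1, ε ^ 2 * x ∈ Set.Icc (0:ℝ) 1 := fun x hx =>
    ⟨mul_nonneg hε2.le hx.1, by nlinarith [hx.1, hx.2]⟩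
  have hc : ContinuousOn (fun x => f (ε ^ 2 * x)) (Set.Icc 0 1) :=
    hcont.comp (by fun_prop) hscale
  have havoid : ∀ x ∈ Set.Icc (0:ℝ) 1, x ∉ Set.Icc u v → f (ε ^ 2 * x) ∉ Set.Icc u v :=
    fun x hx hxuv hmem => hxuv <| hzero x hx <| by
      have h := hfks x hx
      rw [hplat _ hmem] at h
      exact (mul_eq_zero.1 h.symm).resolve_left hε0.ne'
  have hleft : ∀ x ∈ Set.Icc (0:ℝ) 1, x < u → v < f (ε ^ 2 * x) := fun x hx hxu => by
    have hsub : Set.uIcc 0 x ⊆ Set.Icc 0 1 := by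
      rw [Set.uIcc_of_le hx.1]
      exact Set.Icc_subset_Icc_right hx.2
    refine lt_apply_of_avoids_Icc (h := fun x => f (ε ^ 2 * x)) huv.le (hc.mono hsub)
      (fun t ht => havoid t (hsub ht) fun htu => ?_) (by simpa [hf0] using hv)
    rw [Set.uIcc_of_le hx.1] at ht
    linarith [ht.2, htu.1]
  have hright : ∀ x ∈ Set.Icc (0:ℝ) 1, v < x → f (ε ^ 2 * x) < v := fun x hx hvx => by
    have hsub : Set.Icc x 1 ⊆ Set.Icc 0 1 := Set.Icc_subset_Icc_left hx.1
    by_contra! hvf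
    have hlt : v < f (ε ^ 2 * x) := by
      by_contra! h
      exact havoid x hx (fun hm => by linarith [hm.2]) ⟨by linarith, h⟩
    have h1 : v < f (ε ^ 2 * 1) := by
      rw [← Set.uIcc_of_le hx.2] at hsub
      refine lt_apply_of_avoids_Icc (h := fun x => f (ε ^ 2 * x)) huv.le (hc.mono hsub)
        (fun t ht => havoid t (hsub ht) fun htu => ?_) hlt
      rw [Set.uIcc_of_le hx.2] at ht
      linarith [ht.1, htu.2]
    rw [mul_one] at h1
    linarith
  refine ⟨fun x hx => ?_, fun x _ => by simp [hg], ?_, fun x hx => ?_⟩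
  · have hf := hmap (⟨abs_nonneg x, abs_le.2 hx⟩ : |x| ∈ Set.Icc (0:ℝ) 1)
    rw [hg]
    rcases Real.sign_apply_eq (v - |x|) with h | h | h <;> rw [h] <;>
      constructor <;> linarith [hf.1, hf.2]
  · rw [hg, abs_zero, hf0, sub_zero, Real.sign_of_pos (by linarith), one_mul]
  · have hx1 : |x| ∈ Set.Icc (0:ℝ) 1 := ⟨abs_nonneg x, abs_le.2 hx⟩
    have hy := hmap (hscale _ hx1)
    have hle : ε ^ 2 * |x| ≤ ε ^ 2 := mul_le_of_le_one_right hε2.le hx1.2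
    have hgy : g (ε ^ 2 * x) = f (ε ^ 2 * |x|) := by
      rw [hg, abs_mul, abs_of_pos hε2, Real.sign_of_pos (by linarith), one_mul]
    rw [hgy, hg, hg x, abs_of_nonneg hy.1, hfks _ hx1]
    rcases lt_or_ge |x| u with hxu | hux
    · rw [Real.sign_of_neg (by linarith [hleft _ hx1 hxu]), Real.sign_of_pos (by linarith)]
      ring
    · rcases le_or_gt |x| v with hxv | hvx
      · simp [hplat _ ⟨hux, hxv⟩]
      · rw [Real.sign_of_pos (by linarith [hright _ hx1 hvx]), Real.sign_of_neg (by linarith)]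
        ring
end

section
/- Let ε be a real number with 0 < ε < 1 and let g : [-1,1] → [-1,1] be an even solution of the Feigenbaum–Kadanoff–Shenker equation (g(-x) = g(x) for all x ∈ [-1,1], g(0) = 1, and g(g(ε²x)) = -ε g(x) for all x ∈ [-1,1]). Then the function f : [0,1] → [0,1] defined by f(x) = |g(x)| satisfies f(0) = 1 and f(f(ε²x)) = ε f(x) for all x ∈ [0,1]; that is, f is a solution of the second type of FKS equation. -/
/-- If g is an even solution of the FKS equation, then
f(x) = |g(x)| is a solution of the second type of FKS equation. -/
theorem stmt_18 (ε : ℝ) (hε0 : 0 < ε) (hε1 : ε < 1) (g : ℝ → ℝ)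
    (hgmap : Set.MapsTo g (Set.Icc (-1) 1) (Set.Icc (-1) 1))
    (hgeven : ∀ x ∈ Set.Icc (-1:ℝ) 1, g (-x) = g x)
    (hg0 : g 0 = 1)
    (hgfks : ∀ x ∈ Set.Icc (-1:ℝ) 1, g (g (ε^2 * x)) = -(ε * g x))
    (f : ℝ → ℝ) (hf : ∀ x, f x = |g x|) :
    Set.MapsTo f (Set.Icc 0 1) (Set.Icc 0 1) ∧
    f 0 = 1 ∧
    (∀ x ∈ Set.Icc (0:ℝ) 1, f (f (ε^2 * x)) = ε * f x) := by
  have hmem : ∀ x ∈ Set.Icc (0:ℝ) 1, x ∈ Set.Icc (-1:ℝ) 1 := fun x hx =>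
    ⟨by linarith [hx.1], hx.2⟩
  refine ⟨fun x hx => ?_, by simp [hf, hg0], fun x hx => ?_⟩
  · rw [hf]
    exact ⟨abs_nonneg _, abs_le.mpr (hgmap (hmem x hx))⟩
  · have hsq : ε ^ 2 ≤ 1 := pow_le_one₀ hε0.le hε1.le
    have hscaled : ε ^ 2 * x ∈ Set.Icc (0:ℝ) 1 :=
      ⟨mul_nonneg (sq_nonneg ε) hx.1, mul_le_one₀ hsq hx.1 hx.2⟩
    have hg_abs : g |g (ε ^ 2 * x)| = g (g (ε ^ 2 * x)) := by
      rcases abs_choice (g (ε ^ 2 * x)) with h | h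
      · rw [h]
      · rw [h, hgeven _ (hgmap (hmem _ hscaled))]
    rw [hf (ε ^ 2 * x), hf, hf, hg_abs, hgfks x (hmem x hx), abs_neg, abs_mul, abs_of_pos hε0]
end
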